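/- Let k > ω be a cardinal, let F be an F_σ-subset of the Baire space B(k), and let A ⊆ F. Suppose B(k) ∖ A is a Souslin set in B(k), A is of first category, and A is nowhere σLW(<k) + 𝒢_δσ. Then for every ε > 0 there exists a family 𝒜 = {A(i, α) : i ∈ ω, α ∈ k} of subsets of A such that: (b1) A = ∪𝒜 and every member of 𝒜 has diameter less than ε; (b2) each A(i, α) is of first category and nowhere σLW(<k) + 𝒢_δσ; (b3) each A(i, α) is a nowhere dense closed subset of A and its closure in B(k) is contained in F; (b4) the closures in B(k) of A(i, α) and A(j, β) are disjoint whenever (i, α) ≠ (j, β); (b5) for every i ∈ ω the family {A(i, α) : α ∈ k} is discrete in B(k). -/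

import Mathlib

open Topology Set Filter

universe u v

noncomputable section

/-- Strong zero-dimensionality (`Ind X = 0`): any two disjoint closed sets
can be separated by a clopen set. -/
def StronglyZeroDim (X : Type*) [TopologicalSpace X] : Prop :=
  ∀ A B : Set X, IsClosed A → IsClosed B → Disjoint A B →
    ∃ U : Set X, IsClopen U ∧ A ⊆ U ∧ Disjoint B U

/-- The topological weight of a space: the least cardinality of a base. -/
def topWeight (X : Type u) [TopologicalSpace X] : Cardinal.{u} :=
  ⨅ B : {B : Set (Set X) // TopologicalSpace.IsTopologicalBasis B}, Cardinal.mk B.1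

/-- The space has a base of cardinality `< k`. -/
def WeightLT (X : Type u) [TopologicalSpace X] (k : Cardinal.{u}) : Prop :=
  ∃ B : Set (Set X), TopologicalSpace.IsTopologicalBasis B ∧ Cardinal.mk B < k

/-- Every point has a neighborhood of weight `< k`. -/
def LocallyWeightLT (X : Type u) [TopologicalSpace X] (k : Cardinal.{u}) : Prop :=
  ∀ x : X, ∃ s : Set X, s ∈ nhds x ∧ WeightLT ↥s k

/-- `X ∈ σLW(<k)`: `X` is a countable union of subspaces, each locally of weight `< k`. -/
def SigmaLW (X : Type u) [TopologicalSpace X] (k : Cardinal.{u}) : Prop :=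
  ∃ S : ℕ → Set X, (⋃ n, S n) = Set.univ ∧ ∀ n, LocallyWeightLT ↥(S n) k

/-- A `G_δσ`-subset: a countable union of `G_δ`-sets. -/
def IsGdeltaSigma {Y : Type*} [TopologicalSpace Y] (s : Set Y) : Prop :=
  ∃ G : ℕ → Set Y, (∀ n, IsGδ (G n)) ∧ s = ⋃ n, G n

/-- An `F_σ`-subset: a countable union of closed sets. -/
def IsFsigmaSet {Y : Type*} [TopologicalSpace Y] (s : Set Y) : Prop :=
  ∃ F : ℕ → Set Y, (∀ n, IsClosed (F n)) ∧ s = ⋃ n, F n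

/-- An `F_σδ`-subset: a countable intersection of `F_σ`-sets. -/
def IsFsigmaDelta {Y : Type*} [TopologicalSpace Y] (s : Set Y) : Prop :=
  ∃ F : ℕ → Set Y, (∀ n, IsFsigmaSet (F n)) ∧ s = ⋂ n, F n

/-- An absolute `G_δσ`-set: a metrizable space whose image under every embedding
into a metrizable space is a countable union of `G_δ`-sets. -/
def AbsGdeltaSigma (X : Type u) [TopologicalSpace X] : Prop :=
  TopologicalSpace.MetrizableSpace X ∧
    ∀ (Y : Type u) [TopologicalSpace Y] [TopologicalSpace.MetrizableSpace Y]
      (f : X → Y), Topology.IsEmbedding f → IsGdeltaSigma (Set.range f)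

/-- An absolute `F_σδ`-set: a metrizable space whose image under every embedding
into a metrizable space is an `F_σδ`-set. -/
def AbsFsigmaDelta (X : Type u) [TopologicalSpace X] : Prop :=
  TopologicalSpace.MetrizableSpace X ∧
    ∀ (Y : Type u) [TopologicalSpace Y] [TopologicalSpace.MetrizableSpace Y]
      (f : X → Y), Topology.IsEmbedding f → IsFsigmaDelta (Set.range f)

/-- `X ∈ σLW(<k) + 𝒢_δσ` : `X = A ∪ B` with `A ∈ σLW(<k)` and `B` an absolute
`G_δσ`-set. -/
def SLWplusGDS (X : Type u) [TopologicalSpace X] (k : Cardinal.{u}) : Prop :=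
  ∃ A B : Set X, A ∪ B = Set.univ ∧ SigmaLW ↥A k ∧ AbsGdeltaSigma ↥B

/-- No nonempty open subspace is `σLW(<k) + 𝒢_δσ`. -/
def NowhereSLWplusGDS (X : Type u) [TopologicalSpace X] (k : Cardinal.{u}) : Prop :=
  ∀ U : Set X, IsOpen U → U.Nonempty → ¬ SLWplusGDS ↥U k

/-- A space is of first category if it is meager in itself. -/
def FirstCategory (X : Type*) [TopologicalSpace X] : Prop :=
  IsMeagre (Set.univ : Set X)

/-- A Souslin (analytic) subset of a space:
`s = ⋃_{t ∈ ω^ω} ⋂_n F(t↾n)` for a family of closed sets indexed by finite tuples. -/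
def IsSuslinIn {Y : Type*} [TopologicalSpace Y] (s : Set Y) : Prop :=
  ∃ F : List ℕ → Set Y, (∀ l, IsClosed (F l)) ∧
    s = ⋃ t : ℕ → ℕ, ⋂ n : ℕ, F (List.ofFn fun i : Fin n => t i)

/-- An absolute Souslin space: metrizable, and Souslin in every completely metrizable
space into which it embeds. -/
def AbsSuslin (X : Type u) [TopologicalSpace X] : Prop :=
  TopologicalSpace.MetrizableSpace X ∧
    ∀ (Y : Type u) [MetricSpace Y] [CompleteSpace Y] (f : X → Y),
      Topology.IsEmbedding f → IsSuslinIn (Set.range f)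

/-- An h-homogeneous space: every nonempty clopen subset is homeomorphic to the
whole space. -/
def HHomogeneous (X : Type*) [TopologicalSpace X] : Prop :=
  ∀ U : Set X, IsClopen U → U.Nonempty → Nonempty (↥U ≃ₜ X)

/-- A discrete family of sets: every point has a neighborhood meeting at most one
member of the family. -/
def DiscreteFamily {X : Type*} [TopologicalSpace X] {ι : Type*} (f : ι → Set X) : Prop :=
  ∀ x : X, ∃ U ∈ nhds x, {i | (f i ∩ U).Nonempty}.Subsingleton

/-- A discrete space of cardinality `k`. -/
def DiscT (k : Cardinal.{u}) : Type u := k.out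

instance (k : Cardinal.{u}) : TopologicalSpace (DiscT k) := ⊥
instance (k : Cardinal.{u}) : DiscreteTopology (DiscT k) := ⟨rfl⟩

/-- The Baire space `B(k) = k^ω`. -/
def BaireB (k : Cardinal.{u}) : Type u := ℕ → DiscT k

instance (k : Cardinal.{u}) : TopologicalSpace (BaireB k) :=
  inferInstanceAs (TopologicalSpace (ℕ → DiscT k))

open Classical in
/-- The discrete factor of `B*(k)`: two points if `k = ℵ₀`, and `k` points otherwise. -/
def StarT (k : Cardinal.{u}) : Type u :=
  if k = Cardinal.aleph0 then ULift Bool else DiscT k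

instance (k : Cardinal.{u}) : TopologicalSpace (StarT k) := ⊥
instance (k : Cardinal.{u}) : DiscreteTopology (StarT k) := ⟨rfl⟩

/-- `B*(k)`: the Cantor set `2^ω` if `k = ℵ₀`, and the Baire space `B(k)` if `k > ℵ₀`. -/
def BaireStar (k : Cardinal.{u}) : Type u := ℕ → StarT k

instance (k : Cardinal.{u}) : TopologicalSpace (BaireStar k) :=
  inferInstanceAs (TopologicalSpace (ℕ → StarT k))

/-- A discrete space of cardinality `k` (for infinite `k`), with a distinguished basepoint. -/
def QBase (k : Cardinal.{u}) : Type u := DiscT k ⊕ PUnit.{u + 1}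

instance (k : Cardinal.{u}) : TopologicalSpace (QBase k) := ⊥
instance (k : Cardinal.{u}) : DiscreteTopology (QBase k) := ⟨rfl⟩

/-- `Q(k)`: the σ-product of `ω` copies of a discrete space of cardinality `k`, i.e.
the subspace of the product consisting of the sequences eventually equal to the basepoint. -/
def Qk (k : Cardinal.{u}) : Type u :=
  {x : ℕ → QBase k // ∀ᶠ n in Filter.atTop, x n = Sum.inr PUnit.unit}

instance (k : Cardinal.{u}) : TopologicalSpace (Qk k) :=
  inferInstanceAs (TopologicalSpace
    {x : ℕ → QBase k // ∀ᶠ n in Filter.atTop, x n = Sum.inr PUnit.unit})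

/-- The countable power `Q(k)^ω`. -/
def QkOmega (k : Cardinal.{u}) : Type u := ℕ → Qk k

instance (k : Cardinal.{u}) : TopologicalSpace (QkOmega k) :=
  inferInstanceAs (TopologicalSpace (ℕ → Qk k))

/-- `Z` is homeomorphic to `Q(k)^ω`. -/
def IsQkOmega (k : Cardinal.{u}) (Z : Type*) [TopologicalSpace Z] : Prop :=
  Nonempty (Z ≃ₜ QkOmega k)

/-- `Z` is homeomorphic to `A^{II}_k`, the complement in `B*(k)` of a dense copy of
`Q(k)^ω`. -/
def IsAII (k : Cardinal.{u}) (Z : Type*) [TopologicalSpace Z] : Prop :=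
  ∃ A : Set (BaireStar k), Dense A ∧ IsQkOmega k ↥A ∧ Nonempty (Z ≃ₜ ↥(Aᶜ))

/-- `Z` is homeomorphic to `A^I_k = Q × A^{II}_k`. -/
def IsAI (k : Cardinal.{u}) (Z : Type*) [TopologicalSpace Z] : Prop :=
  ∃ A : Set (BaireStar k), Dense A ∧ IsQkOmega k ↥A ∧ Nonempty (Z ≃ₜ (ℚ × ↥(Aᶜ)))

/-- `Z` is homeomorphic to `M^{II}_k`, the complement in `B*(k)` of a dense copy of
`A^I_k`. -/
def IsMII (k : Cardinal.{u}) (Z : Type*) [TopologicalSpace Z] : Prop :=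
  ∃ Y : Set (BaireStar k), Dense Y ∧ IsAI k ↥Y ∧ Nonempty (Z ≃ₜ ↥(Yᶜ))

/-- `X ∈ 𝓕_σδ ∖ σLW(<k)`: `X` is homeomorphic to `F ∖ L` for some absolute
`F_σδ`-space `F` and some `L ⊆ F` with `L ∈ σLW(<k)`. -/
def FsdMinusSLW (X : Type u) [TopologicalSpace X] (k : Cardinal.{u}) : Prop :=
  ∃ (F : TopCat.{u}) (L : Set F), AbsFsigmaDelta ↥F ∧ SigmaLW ↥L k ∧
    Nonempty (X ≃ₜ ↥(Lᶜ))

/-- No nonempty open subspace is in the class `𝓕_σδ ∖ σLW(<k)`. -/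
def NowhereFsdMinusSLW (X : Type u) [TopologicalSpace X] (k : Cardinal.{u}) : Prop :=
  ∀ U : Set X, IsOpen U → U.Nonempty → ¬ FsdMinusSLW ↥U k

/-- A topologically complete (i.e. completely metrizable) space. -/
def CompletelyMetrizable (X : Type*) [t : TopologicalSpace X] : Prop :=
  ∃ m : MetricSpace X, m.toUniformSpace.toTopologicalSpace = t ∧
    @CompleteSpace X m.toUniformSpace

end
/-- The standard complete metric on the Baire space `B(k)`:
`dist x y = (1/2)^n` where `n` is the first index where `x` and `y` differ. -/
noncomputable instance (k : Cardinal.{u}) : MetricSpace (BaireB k) :=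
  PiNat.metricSpace (E := fun _ : ℕ => DiscT k)


namespace Pf

variable {k : Cardinal.{u}}

/-- The cylinder of length `n` around `x`. -/
def cyl (x : BaireB k) (n : ℕ) : Set (BaireB k) := PiNat.cylinder (E := fun _ => DiscT k) x n

theorem mem_cyl {x y : BaireB k} {n : ℕ} : y ∈ cyl x n ↔ ∀ i < n, y i = x i := Iff.rfl

theorem self_mem_cyl (x : BaireB k) (n : ℕ) : x ∈ cyl x n := fun _ _ => rfl

theorem cyl_open (x : BaireB k) (n : ℕ) : IsOpen (cyl x n) :=
  PiNat.isOpen_cylinder (E := fun _ => DiscT k) x n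

theorem cyl_anti (x : BaireB k) {m n : ℕ} (h : m ≤ n) : cyl x n ⊆ cyl x m :=
  PiNat.cylinder_anti (E := fun _ => DiscT k) x h

theorem cyl_eq {x y : BaireB k} {n : ℕ} (h : y ∈ cyl x n) : cyl y n = cyl x n :=
  PiNat.mem_cylinder_iff_eq.1 h

theorem cyl_closed (x : BaireB k) (n : ℕ) : IsClosed (cyl x n) := by
  rw [← isOpen_compl_iff, isOpen_iff_forall_mem_open]
  intro y hy
  refine ⟨cyl y n, ?_, cyl_open y n, self_mem_cyl y n⟩
  intro z hz hz'
  apply hy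
  rw [← cyl_eq hz', cyl_eq hz]
  exact self_mem_cyl y n

theorem exists_cyl {O : Set (BaireB k)} (hO : IsOpen O) {x : BaireB k} (hx : x ∈ O) :
    ∃ n, cyl x n ⊆ O := by
  obtain ⟨s, ⟨y, n, rfl⟩, hxs, hs⟩ :=
    (PiNat.isTopologicalBasis_cylinders (E := fun _ => DiscT k)).exists_subset_of_mem_open hx hO
  refine ⟨n, ?_⟩
  have : cyl x n = cyl y n := cyl_eq hxs
  rw [this]; exact hs

theorem exists_cyl_disj {D : Set (BaireB k)} (hD : IsClosed D) {x : BaireB k} (hx : x ∉ D) :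
    ∃ n, Disjoint (cyl x n) D := by
  obtain ⟨n, hn⟩ := exists_cyl hD.isOpen_compl hx
  exact ⟨n, disjoint_left.2 fun y hy => hn hy⟩

/-- The least level at which the cylinder satisfies `R`. -/
noncomputable def lev (R : Set (BaireB k) → Prop) (x : BaireB k) : ℕ := sInf {n | R (cyl x n)}

/-- The maximal cylinder satisfying `R`. -/
noncomputable def mc (R : Set (BaireB k) → Prop) (x : BaireB k) : Set (BaireB k) := cyl x (lev R x)

theorem mc_spec {R : Set (BaireB k) → Prop} {x : BaireB k} (h : ∃ n, R (cyl x n)) : R (mc R x) :=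
  Nat.sInf_mem (s := {n | R (cyl x n)}) h

theorem self_mem_mc (R : Set (BaireB k) → Prop) (x : BaireB k) : x ∈ mc R x := self_mem_cyl _ _

theorem lev_eq {R : Set (BaireB k) → Prop} {x y : BaireB k} (h : ∃ n, R (cyl x n))
    (hy : y ∈ mc R x) : lev R y = lev R x := by
  have h1 : R (cyl y (lev R x)) := by
    rw [cyl_eq hy]; exact mc_spec h
  have h2 : lev R y ≤ lev R x := Nat.sInf_le h1
  refine le_antisymm h2 ?_
  apply Nat.sInf_le
  have h3 : cyl y (lev R y) = cyl x (lev R y) := cyl_eq (cyl_anti x h2 hy)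
  change R (cyl x (lev R y))
  rw [← h3]
  exact mc_spec (R := R) ⟨_, h1⟩

theorem mc_eq {R : Set (BaireB k) → Prop} {x y : BaireB k} (h : ∃ n, R (cyl x n))
    (hy : y ∈ mc R x) : mc R y = mc R x := by
  unfold mc
  rw [lev_eq h hy]
  exact cyl_eq hy

theorem mc_sub {R : Set (BaireB k) → Prop} {x : BaireB k} {n : ℕ}
    (h : ∀ m ≤ n, ¬ R (cyl x m)) (h' : ∃ n, R (cyl x n)) : mc R x ⊆ cyl x n := by
  apply cyl_anti
  by_contra hc
  push Not at hc
  exact h _ hc.le (mc_spec h')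

theorem mc_open (R : Set (BaireB k) → Prop) (x : BaireB k) : IsOpen (mc R x) := cyl_open _ _

theorem mc_closed (R : Set (BaireB k) → Prop) (x : BaireB k) : IsClosed (mc R x) := cyl_closed _ _

/-- the family of maximal cylinders -/
def mcs (R : Set (BaireB k) → Prop) : Set (Set (BaireB k)) :=
  {c | ∃ x, (∃ n, R (cyl x n)) ∧ c = mc R x}

theorem mcs_disj (R : Set (BaireB k) → Prop) : (mcs R).PairwiseDisjoint id := by
  rintro _ ⟨x, hx, rfl⟩ _ ⟨y, hy, rfl⟩ hne
  rw [Function.onFun, id, id, disjoint_left]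
  intro z hz hz'
  exact hne ((mc_eq hx hz).symm.trans (mc_eq hy hz'))

theorem mcs_open {R : Set (BaireB k) → Prop} : ∀ c ∈ mcs R, IsOpen c := by
  rintro _ ⟨x, hx, rfl⟩; exact mc_open _ _

theorem mcs_spec {R : Set (BaireB k) → Prop} : ∀ c ∈ mcs R, R c := by
  rintro _ ⟨x, hx, rfl⟩; exact mc_spec hx

instance : TopologicalSpace.IsCompletelyMetrizableSpace (BaireB k) :=
  inferInstanceAs (TopologicalSpace.IsCompletelyMetrizableSpace (ℕ → DiscT k))

instance : TopologicalSpace.MetrizableSpace (BaireB k) :=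
  inferInstanceAs (TopologicalSpace.MetrizableSpace (ℕ → DiscT k))

theorem closed_gd {E : Set (BaireB k)} (h : IsClosed E) : IsGδ E := by
  let _ := TopologicalSpace.metrizableSpaceMetric (BaireB k)
  exact h.isGδ

/-! ### weight -/

theorem WeightLT.of_emb {X Y : Type u} [TopologicalSpace X] [TopologicalSpace Y] {f : X → Y}
    (hf : IsInducing f) (h : WeightLT Y k) : WeightLT X k := by
  obtain ⟨B, hB, hc⟩ := h
  refine ⟨preimage f '' B, ?_, Cardinal.mk_image_le.trans_lt hc⟩
  have := hB.induced f
  rwa [← hf.eq_induced] at this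

/-- subset version of local weight -/
def lw (S : Set (BaireB k)) : Prop := ∀ x ∈ S, ∃ O, IsOpen O ∧ x ∈ O ∧ WeightLT ↥(S ∩ O) k

theorem incl_ind {X : Type*} [TopologicalSpace X] {S T : Set X} (h : S ⊆ T) :
    IsInducing (Set.inclusion h) := (IsEmbedding.inclusion h).isInducing

theorem lw_mono {S T : Set (BaireB k)} (h : S ⊆ T) (hT : lw T) : lw S := by
  intro x hx
  obtain ⟨O, hO, hxO, hw⟩ := hT x (h hx)
  exact ⟨O, hO, hxO, WeightLT.of_emb (incl_ind (inter_subset_inter_left O h)) hw⟩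

theorem lw_of_emb {X : Type u} [TopologicalSpace X] {g : X → BaireB k} (hg : IsEmbedding g)
    (h : LocallyWeightLT X k) : lw (range g) := by
  rintro _ ⟨x, rfl⟩
  obtain ⟨s, hs, hw⟩ := h x
  rw [hg.nhds_eq_comap, mem_comap] at hs
  obtain ⟨t, ht, hts⟩ := hs
  obtain ⟨O, hOt, hO, hxO⟩ := mem_nhds_iff.1 ht
  refine ⟨O, hO, hxO, ?_⟩
  have key : ∀ y : ↥(range g ∩ O), ∃ z : ↥s, g z = y := by
    rintro ⟨_, ⟨z, rfl⟩, hz⟩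
    exact ⟨⟨z, hts (hOt hz)⟩, rfl⟩
  choose f hf using key
  refine WeightLT.of_emb (f := f) ?_ hw
  have h1 : IsInducing (fun z : ↥s => g z) := hg.isInducing.comp IsInducing.subtypeVal
  rw [← h1.of_comp_iff]
  have : (fun z : ↥s => g z) ∘ f = Subtype.val := funext hf
  rw [this]
  exact IsInducing.subtypeVal

theorem of_lw {X : Type u} [TopologicalSpace X] {g : X → BaireB k} (hg : IsInducing g)
    {S : Set (BaireB k)} (h : lw S) (hS : range g ⊆ S) : LocallyWeightLT X k := by
  intro x
  obtain ⟨O, hO, hxO, hw⟩ := h (g x) (hS ⟨x, rfl⟩)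
  refine ⟨g ⁻¹' O, hg.continuous.continuousAt (hO.mem_nhds hxO), ?_⟩
  refine WeightLT.of_emb (f := fun z : ↥(g ⁻¹' O) => (⟨g z, hS ⟨z, rfl⟩, z.2⟩ : ↥(S ∩ O))) ?_ hw
  rw [← IsInducing.subtypeVal.of_comp_iff]
  exact hg.comp IsInducing.subtypeVal

/-- subset version of `σLW(<k) + 𝒢_δσ` -/
def PP (R : Set (BaireB k)) : Prop :=
  ∃ S G : ℕ → Set (BaireB k), (∀ n, lw (S n)) ∧ (∀ n, IsGδ (G n)) ∧ R = (⋃ n, S n) ∪ ⋃ n, G n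

theorem lw_empty : lw (∅ : Set (BaireB k)) := fun _ h => h.elim

theorem PP_gd {G : Set (BaireB k)} (h : IsGδ G) : PP G :=
  ⟨fun _ => ∅, fun _ => G, fun _ => lw_empty, fun _ => h, by simp [iUnion_const]⟩

theorem PP_empty : PP (∅ : Set (BaireB k)) := PP_gd IsGδ.empty

theorem PP_iUnion {R : ℕ → Set (BaireB k)} (h : ∀ n, PP (R n)) : PP (⋃ n, R n) := by
  choose S G hS hG hR using h
  refine ⟨fun m => S m.unpair.1 m.unpair.2, fun m => G m.unpair.1 m.unpair.2,
    fun n => hS _ _, fun n => hG _ _, ?_⟩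
  rw [Set.iUnion_unpair S, Set.iUnion_unpair G, ← iUnion_union_distrib]
  exact iUnion_congr hR

theorem PP_union {R T : Set (BaireB k)} (h : PP R) (h' : PP T) : PP (R ∪ T) := by
  have : R ∪ T = ⋃ n : ℕ, if n = 0 then R else T := by
    ext x; simp only [mem_union, mem_iUnion]
    constructor
    · rintro (h | h)
      · exact ⟨0, by simpa⟩
      · exact ⟨1, by simpa⟩
    · rintro ⟨n, hn⟩
      split_ifs at hn <;> tauto
  rw [this]
  apply PP_iUnion
  intro n; split_ifs <;> assumption

theorem PP_inter {R E : Set (BaireB k)} (h : PP R) (hE : IsGδ E) : PP (R ∩ E) := by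
  obtain ⟨S, G, hS, hG, rfl⟩ := h
  refine ⟨fun n => S n ∩ E, fun n => G n ∩ E, fun n => lw_mono inter_subset_left (hS n),
    fun n => (hG n).inter hE, ?_⟩
  rw [union_inter_distrib_right, iUnion_inter, iUnion_inter]

theorem gd_disj {C : Set (Set (BaireB k))} (hC : C.PairwiseDisjoint id) (ho : ∀ c ∈ C, IsOpen c)
    {H : Set (BaireB k) → Set (BaireB k)} (hH : ∀ c ∈ C, IsGδ (H c)) :
    IsGδ (⋃ c ∈ C, H c ∩ c) := by
  have : ∀ c, ∃ f : ℕ → Set (BaireB k), c ∈ C → (∀ n, IsOpen (f n)) ∧ H c = ⋂ n, f n := by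
    intro c
    by_cases hc : c ∈ C
    · obtain ⟨f, h1, h2⟩ := (hH c hc).eq_iInter_nat
      exact ⟨f, fun _ => ⟨h1, h2⟩⟩
    · exact ⟨fun _ => ∅, fun h => (hc h).elim⟩
  choose f hf using this
  have : (⋃ c ∈ C, H c ∩ c) = ⋂ n, ⋃ c ∈ C, f c n ∩ c := by
    ext x
    simp only [mem_iUnion, mem_iInter, exists_prop, mem_inter_iff]
    constructor
    · rintro ⟨c, hc, h1, h2⟩ n
      rw [(hf c hc).2] at h1
      exact ⟨c, hc, mem_iInter.1 h1 n, h2⟩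
    · intro h
      obtain ⟨c, hc, h1, h2⟩ := h 0
      refine ⟨c, hc, ?_, h2⟩
      rw [(hf c hc).2, mem_iInter]
      intro n
      obtain ⟨d, hd, h3, h4⟩ := h n
      have : c = d := hC.elim_set hc hd x h2 h4
      rw [this]; exact h3
  rw [this]
  refine IsGδ.iInter_of_isOpen fun n => isOpen_biUnion fun c hc => ((hf c hc).1 n).inter (ho c hc)

theorem lw_disj {C : Set (Set (BaireB k))} (hC : C.PairwiseDisjoint id) (ho : ∀ c ∈ C, IsOpen c)
    {H : Set (BaireB k) → Set (BaireB k)} (hH : ∀ c ∈ C, lw (H c)) :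
    lw (⋃ c ∈ C, H c ∩ c) := by
  intro x hx
  simp only [mem_iUnion, exists_prop] at hx
  obtain ⟨c, hc, h1, h2⟩ := hx
  obtain ⟨O, hO, hxO, hw⟩ := hH c hc x h1
  refine ⟨O ∩ c, hO.inter (ho c hc), ⟨hxO, h2⟩, ?_⟩
  have : (⋃ c ∈ C, H c ∩ c) ∩ (O ∩ c) ⊆ H c ∩ O := by
    rintro y ⟨hy, hyO, hyc⟩
    simp only [mem_iUnion, exists_prop] at hy
    obtain ⟨d, hd, h3, h4⟩ := hy
    have : c = d := hC.elim_set hc hd y hyc h4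
    subst this
    exact ⟨h3, hyO⟩
  exact WeightLT.of_emb (incl_ind this) hw

theorem PP_disj {C : Set (Set (BaireB k))} (hC : C.PairwiseDisjoint id) (ho : ∀ c ∈ C, IsOpen c)
    {H : Set (BaireB k) → Set (BaireB k)} (hH : ∀ c ∈ C, PP (H c)) :
    PP (⋃ c ∈ C, H c ∩ c) := by
  have : ∀ c, ∃ S G : ℕ → Set (BaireB k), c ∈ C → (∀ n, lw (S n)) ∧ (∀ n, IsGδ (G n)) ∧
      H c = (⋃ n, S n) ∪ ⋃ n, G n := by
    intro c
    by_cases hc : c ∈ C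
    · obtain ⟨S, G, h⟩ := hH c hc
      exact ⟨S, G, fun _ => h⟩
    · exact ⟨fun _ => ∅, fun _ => ∅, fun h => (hc h).elim⟩
  choose S G h using this
  refine ⟨fun n => ⋃ c ∈ C, S c n ∩ c, fun n => ⋃ c ∈ C, G c n ∩ c,
    fun n => lw_disj hC ho fun c hc => (h c hc).1 n,
    fun n => gd_disj hC ho fun c hc => (h c hc).2.1 n, ?_⟩
  ext x
  simp only [mem_iUnion, mem_union, exists_prop, mem_inter_iff]
  constructor
  · rintro ⟨c, hc, h1, h2⟩
    rw [(h c hc).2.2] at h1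
    rcases h1 with h1 | h1
    · obtain ⟨n, hn⟩ := mem_iUnion.1 h1
      exact Or.inl ⟨n, c, hc, hn, h2⟩
    · obtain ⟨n, hn⟩ := mem_iUnion.1 h1
      exact Or.inr ⟨n, c, hc, hn, h2⟩
  · rintro (⟨n, c, hc, h1, h2⟩ | ⟨n, c, hc, h1, h2⟩)
    · exact ⟨c, hc, by rw [(h c hc).2.2]; exact Or.inl (mem_iUnion.2 ⟨n, h1⟩), h2⟩
    · exact ⟨c, hc, by rw [(h c hc).2.2]; exact Or.inr (mem_iUnion.2 ⟨n, h1⟩), h2⟩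

/-! ### Lavrentiev -/

theorem lavrentiev {T B Y : Type*} [TopologicalSpace T] [TopologicalSpace B]
    [TopologicalSpace.IsCompletelyMetrizableSpace B]
    [TopologicalSpace Y] [TopologicalSpace.MetrizableSpace Y] {g : T → B} (hg : IsEmbedding g)
    (hG : IsGδ (range g)) {f : T → Y} (hf : IsEmbedding f) : IsGδ (range f) := by
  let _ := TopologicalSpace.upgradeIsCompletelyMetrizable B
  let _ := TopologicalSpace.metrizableSpaceMetric Y
  obtain ⟨U, hU, hUe⟩ := hG.eq_iInter_nat
  let O : ℕ → Set Y := fun n => ⋃₀ {V | IsOpen V ∧ closure (g '' (f ⁻¹' V)) ⊆ U n ∧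
    ∀ x ∈ f ⁻¹' V, ∀ y ∈ f ⁻¹' V, dist (g x) (g y) < 1 / ((n : ℝ) + 1)}
  have hO : ∀ n, IsOpen (O n) := fun n => isOpen_sUnion fun V hV => hV.1
  have : range f = closure (range f) ∩ ⋂ n, O n := by
    apply subset_antisymm
    · refine subset_inter subset_closure (subset_iInter fun n => ?_)
      rintro _ ⟨t, rfl⟩
      have h1 : g t ∈ U n := by
        have : g t ∈ range g := ⟨t, rfl⟩
        rw [hUe] at this
        exact mem_iInter.1 this n
      obtain ⟨r, hr, hrU⟩ := Metric.isOpen_iff.1 (hU n) _ h1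
      let q := min (r / 2) (1 / (2 * ((n : ℝ) + 1)))
      have hq : 0 < q := by positivity
      have h2 : g ⁻¹' (Metric.ball (g t) q) ∈ 𝓝 t :=
        hg.continuous.continuousAt (Metric.ball_mem_nhds _ hq)
      rw [hf.nhds_eq_comap, mem_comap] at h2
      obtain ⟨W, hW, hWs⟩ := h2
      obtain ⟨V, hVW, hV, htV⟩ := mem_nhds_iff.1 hW
      have h3 : ∀ x ∈ f ⁻¹' V, dist (g x) (g t) < q := fun x hx => hWs (hVW hx)
      refine ⟨V, ⟨hV, ?_, ?_⟩, htV⟩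
      · have : g '' (f ⁻¹' V) ⊆ Metric.closedBall (g t) q := by
          rintro _ ⟨x, hx, rfl⟩
          exact (h3 x hx).le
        refine (closure_minimal this Metric.isClosed_closedBall).trans ?_
        refine (Metric.closedBall_subset_ball ?_).trans hrU
        have : q ≤ r / 2 := min_le_left _ _
        linarith
      · intro x hx y hy
        have hq2 : q ≤ 1 / (2 * ((n : ℝ) + 1)) := min_le_right _ _
        have e : 1 / ((n : ℝ) + 1) = 1 / (2 * ((n : ℝ) + 1)) + 1 / (2 * ((n : ℝ) + 1)) := by
          field_simp; norm_num
        have := dist_triangle_right (g x) (g y) (g t)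
        rw [e]
        linarith [h3 x hx, h3 y hy]
    · rintro y ⟨hy, hyO⟩
      rw [mem_iInter] at hyO
      let L : Filter B := map g (comap f (𝓝 y))
      have : (comap f (𝓝 y)).NeBot := by
        rw [comap_neBot_iff]
        intro t ht
        obtain ⟨_, h1, ⟨x, rfl⟩⟩ := mem_closure_iff_nhds.1 hy t ht
        exact ⟨x, h1⟩
      have hC : Cauchy L := by
        rw [Metric.cauchy_iff]
        refine ⟨inferInstance, fun e he => ?_⟩
        obtain ⟨n, hn⟩ := exists_nat_one_div_lt he
        obtain ⟨V, ⟨hV, _, hd⟩, hyV⟩ := hyO n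
        refine ⟨g '' (f ⁻¹' V), image_mem_map (preimage_mem_comap (hV.mem_nhds hyV)), ?_⟩
        rintro _ ⟨x, hx, rfl⟩ _ ⟨z, hz, rfl⟩
        exact (hd x hx z hz).trans hn
      obtain ⟨b, hb⟩ := CompleteSpace.complete hC
      have hbG : b ∈ range g := by
        rw [hUe, mem_iInter]
        intro n
        obtain ⟨V, ⟨hV, hc, _⟩, hyV⟩ := hyO n
        apply hc
        have : L.NeBot := inferInstance
        exact mem_closure_of_tendsto (f := id) (b := L) hb
          (image_mem_map (preimage_mem_comap (hV.mem_nhds hyV)))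
      obtain ⟨t, rfl⟩ := hbG
      have h1 : comap f (𝓝 y) ≤ 𝓝 t := by
        rw [hg.nhds_eq_comap]
        exact map_le_iff_le_comap.1 hb
      have h2 : Tendsto f (comap f (𝓝 y)) (𝓝 (f t)) := (hf.continuous.tendsto t).mono_left h1
      have h3 : Tendsto f (comap f (𝓝 y)) (𝓝 y) := tendsto_comap
      exact ⟨t, tendsto_nhds_unique h2 h3⟩
  rw [this]
  exact isClosed_closure.isGδ.inter (IsGδ.iInter_of_isOpen hO)

theorem SLW_iff {Y : Type u} [TopologicalSpace Y] {g : Y → BaireB k} (hg : IsEmbedding g) :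
    SLWplusGDS Y k ↔ PP (range g) := by
  constructor
  · rintro ⟨A, B, hAB, ⟨S, hS, hSl⟩, hB⟩
    have hgB : IsEmbedding (fun b : ↥B => g b) := hg.comp IsEmbedding.subtypeVal
    obtain ⟨G, hG, hGe⟩ := hB.2 (BaireB k) _ hgB
    refine ⟨fun n => range (fun x : ↥(S n) => g x.1.1), G, fun n => lw_of_emb ?_ (hSl n), hG, ?_⟩
    · exact (hg.comp IsEmbedding.subtypeVal).comp IsEmbedding.subtypeVal
    · rw [← hGe]
      ext x
      simp only [mem_union, mem_iUnion, mem_range]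
      constructor
      · rintro ⟨y, rfl⟩
        have : y ∈ A ∪ B := by rw [hAB]; trivial
        rcases this with h | h
        · have : (⟨y, h⟩ : ↥A) ∈ ⋃ n, S n := by rw [hS]; trivial
          obtain ⟨n, hn⟩ := mem_iUnion.1 this
          exact Or.inl ⟨n, ⟨_, hn⟩, rfl⟩
        · exact Or.inr ⟨⟨y, h⟩, rfl⟩
      · rintro (⟨n, y, rfl⟩ | ⟨y, rfl⟩)
        · exact ⟨_, rfl⟩
        · exact ⟨_, rfl⟩
  · rintro ⟨S, G, hS, hG, he⟩
    refine ⟨g ⁻¹' ⋃ n, S n, g ⁻¹' ⋃ n, G n, ?_, ?_, ?_, ?_⟩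
    · rw [← preimage_union, ← he, preimage_range]
    · refine ⟨fun n => {x | g x.1 ∈ S n}, ?_, fun n => ?_⟩
      · ext x
        simp only [mem_iUnion, mem_univ, iff_true]
        have := mem_iUnion.1 (show g x.1 ∈ ⋃ n, S n from x.2)
        exact this
      · refine of_lw (g := fun x : ↥{x : ↥(g ⁻¹' ⋃ n, S n) | g x.1 ∈ S n} => g x.1.1) ?_ (hS n) ?_
        · exact (hg.isInducing.comp IsInducing.subtypeVal).comp IsInducing.subtypeVal
        · rintro _ ⟨x, rfl⟩; exact x.2
    · exact (hg.comp IsEmbedding.subtypeVal).metrizableSpace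
    · intro Y' _ _ f hf
      refine ⟨fun n => range (fun x : ↥{x : ↥(g ⁻¹' ⋃ n, G n) | g x.1 ∈ G n} => f x.1),
        fun n => ?_, ?_⟩
      · refine lavrentiev (B := BaireB k)
          (g := fun x : ↥{x : ↥(g ⁻¹' ⋃ n, G n) | g x.1 ∈ G n} => g x.1.1)
          ((hg.comp IsEmbedding.subtypeVal).comp IsEmbedding.subtypeVal) ?_
          (hf.comp IsEmbedding.subtypeVal)
        convert hG n using 1
        ext x
        constructor
        · rintro ⟨y, rfl⟩; exact y.2
        · intro hx
          have h1 : x ∈ ⋃ n, G n := mem_iUnion.2 ⟨n, hx⟩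
          have h2 : x ∈ range g := by rw [he]; exact Or.inr h1
          obtain ⟨y, rfl⟩ := h2
          exact ⟨⟨⟨y, h1⟩, hx⟩, rfl⟩
      · ext y
        simp only [mem_iUnion, mem_range]
        constructor
        · rintro ⟨x, rfl⟩
          obtain ⟨n, hn⟩ := mem_iUnion.1 x.2
          exact ⟨n, ⟨x, hn⟩, rfl⟩
        · rintro ⟨n, x, rfl⟩; exact ⟨_, rfl⟩

/-- nowhere `PP` for subsets -/
def NP (Y : Set (BaireB k)) : Prop := ∀ O, IsOpen O → (O ∩ Y).Nonempty → ¬ PP (O ∩ Y)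

theorem NP_iff {Y : Set (BaireB k)} : NowhereSLWplusGDS ↥Y k ↔ NP Y := by
  have key : ∀ O : Set (BaireB k), SLWplusGDS ↥(Subtype.val ⁻¹' O : Set ↥Y) k ↔ PP (O ∩ Y) := by
    intro O
    rw [SLW_iff (g := fun x : ↥(Subtype.val ⁻¹' O : Set ↥Y) => x.1.1)
      (IsEmbedding.subtypeVal.comp IsEmbedding.subtypeVal)]
    have : range (fun x : ↥(Subtype.val ⁻¹' O : Set ↥Y) => x.1.1) = O ∩ Y := by
      ext x
      constructor
      · rintro ⟨y, rfl⟩; exact ⟨y.2, y.1.2⟩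
      · rintro ⟨h1, h2⟩; exact ⟨⟨⟨x, h2⟩, h1⟩, rfl⟩
    rw [this]
  constructor
  · rintro h O hO ⟨x, hx1, hx2⟩ hP
    exact h (Subtype.val ⁻¹' O) (hO.preimage continuous_subtype_val) ⟨⟨x, hx2⟩, hx1⟩ ((key O).2 hP)
  · rintro h U hU ⟨x, hx⟩ hS
    obtain ⟨O, hO, rfl⟩ := isOpen_induced_iff.1 hU
    exact h O hO ⟨x, hx, x.2⟩ ((key O).1 hS)

/-- relative nowhere density of a closed set `M` in `Y` -/
def ND (Y M : Set (BaireB k)) : Prop := ∀ O, IsOpen O → (O ∩ Y).Nonempty → ((O ∩ Y) \ M).Nonempty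

theorem ND_imp {Y M : Set (BaireB k)} (hM : IsClosed M) (h : ND Y M) :
    IsNowhereDense (Subtype.val ⁻¹' M : Set ↥Y) := by
  rw [(hM.preimage continuous_subtype_val).isNowhereDense_iff, eq_empty_iff_forall_notMem]
  intro x hx
  obtain ⟨U, hUM, hU, hxU⟩ := mem_interior.1 hx
  obtain ⟨O, hO, rfl⟩ := isOpen_induced_iff.1 hU
  obtain ⟨y, ⟨hy1, hy2⟩, hy3⟩ := h O hO ⟨x, hxU, x.2⟩
  exact hy3 (hUM (show (⟨y, hy2⟩ : ↥Y) ∈ _ from hy1))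

theorem ND_of {Y : Set (BaireB k)} {t : Set ↥Y} (h : IsNowhereDense t) :
    ND Y (closure (Subtype.val '' t)) := by
  rintro O hO ⟨x, hxO, hxY⟩
  by_contra hc
  rw [not_nonempty_iff_eq_empty, sdiff_eq_empty] at hc
  have : (⟨x, hxY⟩ : ↥Y) ∈ interior (closure t) := by
    refine mem_interior.2 ⟨Subtype.val ⁻¹' O, ?_, hO.preimage continuous_subtype_val, hxO⟩
    intro y hy
    rw [IsEmbedding.subtypeVal.closure_eq_preimage_closure_image]
    exact hc ⟨hy, y.2⟩
  rw [h] at this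
  exact this

/-- first category for subsets -/
def FC (Y : Set (BaireB k)) : Prop :=
  ∃ M : ℕ → Set (BaireB k), (∀ n, IsClosed (M n)) ∧ (∀ n, ND Y (M n)) ∧ Y ⊆ ⋃ n, M n

theorem FC_iff {Y : Set (BaireB k)} : FirstCategory ↥Y ↔ FC Y := by
  unfold FirstCategory
  constructor
  · intro h
    rw [isMeagre_iff_countable_union_isNowhereDense] at h
    obtain ⟨S, hS, hc, hsub⟩ := h
    have hne : (insert ∅ S).Nonempty := ⟨∅, mem_insert _ _⟩
    obtain ⟨f, hf⟩ := (hc.insert ∅).exists_eq_range hne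
    have hnd : ∀ n, IsNowhereDense (f n) := by
      intro n
      have : f n ∈ insert ∅ S := by rw [hf]; exact ⟨n, rfl⟩
      rcases this with h | h
      · rw [h]; exact isNowhereDense_empty
      · exact hS _ h
    refine ⟨fun n => closure (Subtype.val '' (f n)), fun n => isClosed_closure,
      fun n => ND_of (hnd n), ?_⟩
    intro x hx
    obtain ⟨t, ht, hxt⟩ := hsub (mem_univ (⟨x, hx⟩ : ↥Y))
    have : t ∈ range f := by rw [← hf]; exact mem_insert_of_mem _ ht
    obtain ⟨n, rfl⟩ := this
    exact mem_iUnion.2 ⟨n, subset_closure ⟨_, hxt, rfl⟩⟩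
  · rintro ⟨M, hM, hN, hY⟩
    have : (univ : Set ↥Y) = ⋃ n, Subtype.val ⁻¹' (M n) := by
      ext x
      simp only [mem_univ, mem_iUnion, true_iff]
      have := mem_iUnion.1 (hY x.2)
      exact this
    rw [this]
    exact isMeagre_iUnion fun n => (ND_imp (hM n) (hN n)).isMeagre

end Pf

namespace Pf

variable {k : Cardinal.{u}}

/-- `E` is small with respect to `M`. -/
def sm (X E M : Set (BaireB k)) : Prop :=
  ∃ Q H, Q ⊆ X ∧ PP Q ∧ IsGδ H ∧ Disjoint H M ∧ X ∩ E ⊆ Q ∪ H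

theorem sm_mono {X E E' M : Set (BaireB k)} (h : E' ⊆ E) (hs : sm X E M) : sm X E' M := by
  obtain ⟨Q, H, h1, h2, h3, h4, h5⟩ := hs
  exact ⟨Q, H, h1, h2, h3, h4, (inter_subset_inter_right X h).trans h5⟩

theorem sm_anti {X E M M' : Set (BaireB k)} (h : M' ⊆ M) (hs : sm X E M) : sm X E M' := by
  obtain ⟨Q, H, h1, h2, h3, h4, h5⟩ := hs
  exact ⟨Q, H, h1, h2, h3, h4.mono_right h, h5⟩

theorem sm_union {X E E' M : Set (BaireB k)} (h : sm X E M) (h' : sm X E' M) :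
    sm X (E ∪ E') M := by
  obtain ⟨Q, H, h1, h2, h3, h4, h5⟩ := h
  obtain ⟨Q', H', h1', h2', h3', h4', h5'⟩ := h'
  refine ⟨Q ∪ Q', H ∪ H', union_subset h1 h1', PP_union h2 h2', h3.union h3',
    h4.union_left h4', ?_⟩
  rw [inter_union_distrib_left]
  rintro x (hx | hx)
  · rcases h5 hx with h | h
    · exact Or.inl (Or.inl h)
    · exact Or.inr (Or.inl h)
  · rcases h5' hx with h | h
    · exact Or.inl (Or.inr h)
    · exact Or.inr (Or.inr h)

theorem sm_of_disj {X E M : Set (BaireB k)} (hE : IsGδ E) (h : Disjoint E M) : sm X E M :=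
  ⟨∅, E, empty_subset _, PP_empty, hE, h, fun _ hx => Or.inr hx.2⟩

theorem sm_split {X E : Set (BaireB k)} {M : ℕ → Set (BaireB k)} (h : ∀ n, sm X E (M n)) :
    sm X E (⋃ n, M n) := by
  choose Q H h1 h2 h3 h4 h5 using h
  refine ⟨⋃ n, Q n, ⋂ n, H n, iUnion_subset h1, PP_iUnion h2, IsGδ.iInter h3, ?_, ?_⟩
  · rw [disjoint_iUnion_right]
    exact fun n => (h4 n).mono_left (iInter_subset _ _)
  · intro x hx
    by_cases hc : ∃ n, x ∈ Q n
    · exact Or.inl (mem_iUnion.2 hc)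
    · refine Or.inr (mem_iInter.2 fun n => ?_)
      exact (h5 n hx).resolve_left fun hq => hc ⟨n, hq⟩

theorem sm_disj {X M : Set (BaireB k)} {C : Set (Set (BaireB k))} (hC : C.PairwiseDisjoint id)
    (ho : ∀ c ∈ C, IsOpen c) {E : Set (BaireB k)} (h : ∀ c ∈ C, sm X (E ∩ c) M) :
    sm X (E ∩ ⋃₀ C) M := by
  have : ∀ c, ∃ Q H, c ∈ C → Q ⊆ X ∧ PP Q ∧ IsGδ H ∧ Disjoint H M ∧ X ∩ (E ∩ c) ⊆ Q ∪ H := by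
    intro c
    by_cases hc : c ∈ C
    · obtain ⟨Q, H, h⟩ := h c hc
      exact ⟨Q, H, fun _ => h⟩
    · exact ⟨∅, ∅, fun h => (hc h).elim⟩
  choose Q H h using this
  refine ⟨⋃ c ∈ C, Q c ∩ c, ⋃ c ∈ C, H c ∩ c, ?_, PP_disj hC ho fun c hc => (h c hc).2.1,
    gd_disj hC ho fun c hc => (h c hc).2.2.1, ?_, ?_⟩
  · exact iUnion₂_subset fun c hc => inter_subset_left.trans (h c hc).1
  · rw [disjoint_iUnion₂_left]
    exact fun c hc => ((h c hc).2.2.2.1).mono_left inter_subset_left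
  · rintro x ⟨hX, hE, c, hc, hxc⟩
    rcases (h c hc).2.2.2.2 ⟨hX, hE, hxc⟩ with hq | hq
    · exact Or.inl (mem_iUnion₂.2 ⟨c, hc, hq, hxc⟩)
    · exact Or.inr (mem_iUnion₂.2 ⟨c, hc, hq, hxc⟩)

/-- The open set of all points where `E` is locally small. -/
def smo (X E M : Set (BaireB k)) : Set (BaireB k) := {x | ∃ n, sm X (E ∩ cyl x n) M}

theorem smo_open (X E M : Set (BaireB k)) : IsOpen (smo X E M) := by
  rw [isOpen_iff_forall_mem_open]
  rintro x ⟨n, hn⟩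
  refine ⟨cyl x n, ?_, cyl_open x n, self_mem_cyl x n⟩
  intro y hy
  exact ⟨n, by rwa [cyl_eq hy]⟩

theorem smo_sm (X E M : Set (BaireB k)) : sm X (E ∩ smo X E M) M := by
  refine sm_mono ?_ (sm_disj (mcs_disj fun c => sm X (E ∩ c) M) mcs_open mcs_spec)
  rintro x ⟨hE, hx⟩
  exact ⟨hE, mc _ x, ⟨x, hx, rfl⟩, self_mem_mc _ x⟩

theorem sub_smo {X E M O : Set (BaireB k)} (hO : IsOpen O) (h : sm X (E ∩ O) M) :
    O ⊆ smo X E M := by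
  intro x hx
  obtain ⟨n, hn⟩ := exists_cyl hO hx
  exact ⟨n, sm_mono (inter_subset_inter_right E hn) h⟩

/-- `Z` is nowhere small. -/
def NS (X Z M : Set (BaireB k)) : Prop := ∀ O, IsOpen O → (Z ∩ O).Nonempty → ¬ sm X (Z ∩ O) M

theorem sm_kernel {X E M : Set (BaireB k)} (hE : IsClosed E) (h : ¬ sm X E M) :
    ∃ Z ⊆ E, IsClosed Z ∧ Z.Nonempty ∧ NS X Z M := by
  refine ⟨E \ smo X E M, sdiff_subset, hE.sdiff (smo_open _ _ _), ?_, ?_⟩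
  · by_contra hc
    rw [not_nonempty_iff_eq_empty, sdiff_eq_empty] at hc
    exact h (sm_mono (subset_inter subset_rfl hc) (smo_sm X E M))
  · rintro O hO ⟨x, ⟨hxE, hx⟩, hxO⟩ hs
    refine hx (sub_smo hO ?_ hxO)
    refine sm_mono ?_ (sm_union hs (smo_sm X E M))
    rintro y ⟨hyE, hyO⟩
    by_cases hy : y ∈ smo X E M
    · exact Or.inr ⟨hyE, hy⟩
    · exact Or.inl ⟨⟨hyE, hy⟩, hyO⟩

/-- small in the sense of `PP` -/
theorem sm_univ_iff {X E : Set (BaireB k)} (hE : IsGδ E) : sm X E univ ↔ PP (E ∩ X) := by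
  constructor
  · rintro ⟨Q, H, h1, h2, h3, h4, h5⟩
    have hH : H = ∅ := by rwa [disjoint_univ] at h4
    rw [hH, union_empty] at h5
    have : E ∩ X = Q ∩ E := by
      ext x
      constructor
      · rintro ⟨h6, h7⟩; exact ⟨h5 ⟨h7, h6⟩, h6⟩
      · rintro ⟨h6, h7⟩; exact ⟨h7, h1 h6⟩
    rw [this]
    exact PP_inter h2 hE
  · intro h
    exact ⟨E ∩ X, ∅, inter_subset_right, h, IsGδ.empty, empty_disjoint _,
      fun x hx => Or.inl ⟨hx.2, hx.1⟩⟩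

theorem sm_univ_iUnion {X : Set (BaireB k)} {ι : Type*} [Countable ι] {E : ι → Set (BaireB k)}
    (h : ∀ n, sm X (E n) univ) : sm X (⋃ n, E n) univ := by
  cases isEmpty_or_nonempty ι
  · rw [iUnion_of_empty]
    exact sm_of_disj IsGδ.empty (empty_disjoint _)
  obtain ⟨f, hf⟩ := exists_surjective_nat ι
  choose Q H h1 h2 h3 h4 h5 using h
  refine ⟨⋃ n, Q (f n), ∅, iUnion_subset fun n => h1 _, PP_iUnion fun n => h2 _, IsGδ.empty,
    empty_disjoint _, ?_⟩
  rintro x ⟨hX, hx⟩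
  obtain ⟨i, hi⟩ := mem_iUnion.1 hx
  obtain ⟨n, rfl⟩ := hf i
  refine Or.inl (mem_iUnion.2 ⟨n, ?_⟩)
  have hH : H (f n) = ∅ := by have := h4 (f n); rwa [disjoint_univ] at this
  have := h5 (f n) ⟨hX, hi⟩
  rwa [hH, union_empty] at this

/-- the part of the Souslin set above `s` -/
def Ss (F : List ℕ → Set (BaireB k)) (s : List ℕ) : Set (BaireB k) :=
  {x | ∃ t : ℕ → ℕ, (List.ofFn fun i : Fin s.length => t i) = s ∧
    ∀ n : ℕ, x ∈ F (List.ofFn fun i : Fin n => t i)}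

theorem Ss_sub (F : List ℕ → Set (BaireB k)) (s : List ℕ) : Ss F s ⊆ F s := by
  rintro x ⟨t, ht, hx⟩
  rw [← ht]; exact hx _

theorem ofFn_succ' (t : ℕ → ℕ) (n : ℕ) :
    (List.ofFn fun i : Fin (n + 1) => t i) = (List.ofFn fun i : Fin n => t i) ++ [t n] := by
  rw [List.ofFn_succ_last]; simp

theorem Ss_split (F : List ℕ → Set (BaireB k)) (s : List ℕ) :
    Ss F s ⊆ ⋃ n, Ss F (s ++ [n]) := by
  rintro x ⟨t, ht, hx⟩
  refine mem_iUnion.2 ⟨t s.length, t, ?_, hx⟩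
  have : (s ++ [t s.length]).length = s.length + 1 := by simp
  rw [this, ofFn_succ', ht]

theorem branch_mem {F : List ℕ → Set (BaireB k)} {x : BaireB k} {σ : ℕ → List ℕ}
    (h0 : σ 0 = []) (h1 : ∀ n, ∃ j, σ (n + 1) = σ n ++ [j]) (hx : ∀ n, x ∈ F (σ n)) :
    x ∈ ⋃ t : ℕ → ℕ, ⋂ n : ℕ, F (List.ofFn fun i : Fin n => t i) := by
  choose t ht using h1
  have : ∀ n, σ n = List.ofFn fun i : Fin n => t i := by
    intro n
    induction n with
    | zero => simpa using h0
    | succ n ih => rw [ht, ofFn_succ', ih]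
  refine mem_iUnion.2 ⟨t, mem_iInter.2 fun n => ?_⟩
  rw [← this]; exact hx n

theorem exists_C {X : Set (BaireB k)} {F : List ℕ → Set (BaireB k)} (hF : ∀ l, IsClosed (F l))
    (hX : ∀ x ∈ X, x ∉ ⋃ t : ℕ → ℕ, ⋂ n : ℕ, F (List.ofFn fun i : Fin n => t i))
    {Z : Set (BaireB k)} {s : List ℕ} (hZ : IsClosed Z) (hne : Z.Nonempty) (hNS : NS X Z (Ss F s))
    (hp : ∃ σ : ℕ → List ℕ, ∃ m, σ 0 = [] ∧ σ m = s ∧ (∀ n < m, ∃ j, σ (n + 1) = σ n ++ [j]) ∧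
      ∀ n ≤ m, Z ⊆ F (σ n)) :
    ∃ C ⊆ Z, IsClosed C ∧ C.Nonempty ∧ NS X C univ ∧ ND Z C := by
  by_contra hcon
  have hyp : ∀ C ⊆ Z, IsClosed C → ND Z C → sm X C univ := by
    intro C hCZ hC hN
    by_contra h
    obtain ⟨K, hKC, hK, hKn, hKs⟩ := sm_kernel hC h
    refine hcon ⟨K, hKC.trans hCZ, hK, hKn, hKs, ?_⟩
    intro O hO hOne
    obtain ⟨x, hx1, hx2⟩ := hN O hO hOne
    exact ⟨x, hx1, fun h => hx2 (hKC h)⟩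
  let G : List ℕ → Set (BaireB k) := fun t => smo X Z (Ss F t)
  let N : List ℕ → Set (BaireB k) := fun t => (Z \ G t) ∩ ⋂ j, G (t ++ [j])
  have hZF : ∀ t, Z \ G t ⊆ F t := by
    rintro t z ⟨hz, hzG⟩
    by_contra hzF
    apply hzG
    refine sub_smo (O := (F t)ᶜ) (hF t).isOpen_compl ?_ hzF
    refine sm_of_disj ((closed_gd hZ).inter (hF t).isOpen_compl.isGδ) ?_
    rw [disjoint_left]
    rintro y ⟨_, hy⟩ hy'
    exact hy (Ss_sub F t hy')
  have hNsm : ∀ t, sm X (closure (N t)) univ := by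
    intro t
    have hcl : closure (N t) ⊆ Z \ G t :=
      closure_minimal inter_subset_left (hZ.sdiff (smo_open _ _ _))
    refine hyp _ (hcl.trans sdiff_subset) isClosed_closure ?_
    rintro O hO ⟨z, hzO, hzZ⟩
    by_contra hc
    rw [not_nonempty_iff_eq_empty, sdiff_eq_empty] at hc
    obtain ⟨n, hn⟩ := exists_cyl hO hzO
    have hsub : Z ∩ cyl z n ⊆ closure (N t) := fun y hy => hc ⟨hn hy.2, hy.1⟩
    have h1 : ∀ j, sm X (Z ∩ cyl z n) (Ss F (t ++ [j])) := by
      intro j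
      have h2 : sm X ((Z ∩ cyl z n) \ G (t ++ [j])) univ := by
        refine hyp _ (sdiff_subset.trans inter_subset_left)
          ((hZ.inter (cyl_closed z n)).sdiff (smo_open _ _ _)) ?_
        rintro O' hO' ⟨w, hwO, hwZ⟩
        by_contra hc'
        rw [not_nonempty_iff_eq_empty, sdiff_eq_empty] at hc'
        have hw := hc' ⟨hwO, hwZ⟩
        obtain ⟨v, hv, hvN⟩ := mem_closure_iff.1 (hsub hw.1) O' hO' hwO
        exact (hc' ⟨hv, hvN.1.1⟩).2 (mem_iInter.1 hvN.2 j)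
      refine sm_mono ?_ (sm_union (sm_anti (subset_univ _) h2) (smo_sm X Z (Ss F (t ++ [j]))))
      intro y hy
      by_cases hyG : y ∈ G (t ++ [j])
      · exact Or.inr ⟨hy.1, hyG⟩
      · exact Or.inl ⟨hy, hyG⟩
    have h3 : sm X (Z ∩ cyl z n) (Ss F t) := sm_anti (Ss_split F t) (sm_split h1)
    exact (hcl (hsub ⟨hzZ, self_mem_cyl z n⟩)).2 ⟨n, h3⟩
  have hGs : ∀ z ∈ Z, z ∉ G s := by
    rintro z hz ⟨n, hn⟩
    exact hNS (cyl z n) (cyl_open z n) ⟨z, hz, self_mem_cyl z n⟩ hn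
  have hcov : X ∩ Z ⊆ ⋃ t, closure (N t) := by
    rintro x ⟨hxX, hxZ⟩
    by_contra hx
    have hxN : ∀ t, x ∉ N t := fun t ht => hx (mem_iUnion.2 ⟨t, subset_closure ht⟩)
    have hstep : ∀ t, x ∉ G t → ∃ j, x ∉ G (t ++ [j]) := by
      intro t ht
      by_contra hc
      push Not at hc
      exact hxN t ⟨⟨hxZ, ht⟩, mem_iInter.2 hc⟩
    choose! J hJ using hstep
    let τ : ℕ → List ℕ := fun n => Nat.rec s (fun _ l => l ++ [J l]) n
    have hτ : ∀ n, x ∉ G (τ n) := by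
      intro n
      induction n with
      | zero => exact hGs x hxZ
      | succ n ih => exact hJ _ ih
    obtain ⟨σ, m, hσ0, hσm, hσs, hσF⟩ := hp
    refine hX x hxX (branch_mem (σ := fun n => if n < m then σ n else τ (n - m)) ?_ ?_ ?_)
    · by_cases h : 0 < m
      · simp [h, hσ0]
      · have : m = 0 := by omega
        subst this
        simp only [lt_irrefl, if_false]
        change s = []
        rw [← hσm, hσ0]
    · intro n
      by_cases h : n < m
      · by_cases h' : n + 1 < m
        · rw [if_pos h, if_pos h']; exact hσs n h
        · have : n + 1 = m := by omega
          rw [if_pos h, if_neg h', this, Nat.sub_self]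
          obtain ⟨j, hj⟩ := hσs n h
          refine ⟨j, ?_⟩
          rw [← hj, this, hσm]
          rfl
      · have h' : ¬ n + 1 < m := by omega
        rw [if_neg h, if_neg h']
        have : n + 1 - m = (n - m) + 1 := by omega
        rw [this]
        exact ⟨_, rfl⟩
    · intro n
      split_ifs with h
      · exact hσF n h.le hxZ
      · exact hZF _ ⟨hxZ, hτ _⟩
  obtain ⟨z, hz⟩ := hne
  refine hNS univ isOpen_univ ⟨z, hz, trivial⟩ ?_
  rw [inter_univ]
  obtain ⟨Q, H, h1, h2, h3, h4, h5⟩ := sm_univ_iUnion hNsm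
  exact ⟨Q, H, h1, h2, h3, h4.mono_right (subset_univ _), fun x hx => h5 ⟨hx.1, hcov hx⟩⟩

end Pf

namespace Pf

variable {k : Cardinal.{u}}

/-- nodes of the tree construction -/
structure Nd (X : Set (BaireB k)) (F : List ℕ → Set (BaireB k)) where
  Z : Set (BaireB k)
  C : Set (BaireB k)
  s : List ℕ
  hZ : IsClosed Z
  hNS : NS X Z (Ss F s)
  hp : ∀ p, p <+: s → Z ⊆ F p
  hCZ : C ⊆ Z
  hC : IsClosed C
  hCne : C.Nonempty
  hCN : NS X C univ
  hCD : ND Z C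

theorem NS_sub {X Z : Set (BaireB k)} {F : List ℕ → Set (BaireB k)} (hF : ∀ l, IsClosed (F l))
    {s : List ℕ} (hZ : IsClosed Z) (h : NS X Z (Ss F s)) : Z ⊆ F s := by
  intro z hz
  by_contra hzF
  refine h (F s)ᶜ (hF s).isOpen_compl ⟨z, hz, hzF⟩ ?_
  refine sm_of_disj ((closed_gd hZ).inter (hF s).isOpen_compl.isGδ) ?_
  rw [disjoint_left]
  rintro y ⟨_, hy⟩ hy'
  exact hy (Ss_sub F s hy')

theorem exists_node {X : Set (BaireB k)} {F : List ℕ → Set (BaireB k)} (hF : ∀ l, IsClosed (F l))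
    (hX : ∀ x ∈ X, x ∉ ⋃ t : ℕ → ℕ, ⋂ n : ℕ, F (List.ofFn fun i : Fin n => t i))
    {E : Set (BaireB k)} {s : List ℕ} (hE : IsClosed E) (hsm : ¬ sm X E (Ss F s))
    (hp : ∀ p, p <+: s → p ≠ s → E ⊆ F p) :
    ∃ N : Nd X F, N.Z ⊆ E ∧ N.s = s := by
  obtain ⟨Z, hZE, hZ, hne, hNS⟩ := sm_kernel hE hsm
  have hp' : ∀ p, p <+: s → Z ⊆ F p := by
    intro p hps
    by_cases h : p = s
    · rw [h]; exact NS_sub hF hZ hNS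
    · exact hZE.trans (hp p hps h)
  obtain ⟨C, h1, h2, h3, h4, h5⟩ := exists_C hF hX hZ hne hNS
    ⟨fun n => s.take n, s.length, by simp, by simp, fun n hn =>
      ⟨s[n], by simp⟩, fun n _ => hp' _ (List.take_prefix _ _)⟩
  exact ⟨⟨Z, C, s, hZ, hNS, hp', h1, h2, h3, h4, h5⟩, hZE, rfl⟩

theorem exists_child {X : Set (BaireB k)} {F : List ℕ → Set (BaireB k)}
    (hF : ∀ l, IsClosed (F l))
    (hX : ∀ x ∈ X, x ∉ ⋃ t : ℕ → ℕ, ⋂ n : ℕ, F (List.ofFn fun i : Fin n => t i))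
    (N : Nd X F) (c : Set (BaireB k)) (ho : IsOpen c) (hc : IsClosed c)
    (hne : (N.Z ∩ c).Nonempty) :
    ∃ N' : Nd X F, N'.Z ⊆ N.Z ∩ c ∧ ∃ j, N'.s = N.s ++ [j] := by
  have h := N.hNS c ho hne
  have : ∃ j, ¬ sm X (N.Z ∩ c) (Ss F (N.s ++ [j])) := by
    by_contra hcon
    push Not at hcon
    exact h (sm_anti (Ss_split F N.s) (sm_split hcon))
  obtain ⟨j, hj⟩ := this
  obtain ⟨N', h1, h2⟩ := exists_node hF hX (N.hZ.inter hc) hj (by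
    intro p hp hne
    rw [List.prefix_concat_iff] at hp
    exact inter_subset_left.trans (N.hp p (hp.resolve_left hne)))
  exact ⟨N', h1, j, h2⟩

/-- disjointness from `D` as a predicate on cylinders -/
def Dj (D : Set (BaireB k)) : Set (BaireB k) → Prop := fun c => Disjoint c D

theorem mcD_disj {D : Set (BaireB k)} (hD : IsClosed D) {x : BaireB k} (hx : x ∉ D) :
    Disjoint (mc (Dj D) x) D := mc_spec (R := Dj D) (exists_cyl_disj hD hx)

theorem mcD_sub {D : Set (BaireB k)} (hD : IsClosed D) {x y : BaireB k} (hx : x ∉ D) {n : ℕ}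
    (hy : y ∈ D) (hxy : x ∈ cyl y n) : mc (Dj D) x ⊆ cyl y n := by
  rw [← cyl_eq hxy]
  refine mc_sub ?_ (exists_cyl_disj hD hx)
  intro m hm h
  have h' : Disjoint (cyl x m) D := h
  refine disjoint_left.1 h' ?_ hy
  apply cyl_anti x hm
  rw [cyl_eq hxy]
  exact self_mem_cyl y n

section walk

variable {X : Set (BaireB k)} {F : List ℕ → Set (BaireB k)}

/-- the walk of a point along the tree -/
noncomputable def walk (root : Nd X F) (ch : Nd X F → Set (BaireB k) → Nd X F) (y : BaireB k) :
    ℕ → Nd X F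
  | 0 => root
  | n + 1 => ch (walk root ch y n) (mc (Dj (walk root ch y n).C) y)

/-- points stopping at step `n` -/
def TT (w : BaireB k → ℕ → Nd X F) (n : ℕ) : Set (BaireB k) :=
  {y | y ∈ (w y n).C ∧ ∀ i < n, y ∈ (w y i).Z ∧ y ∉ (w y i).C}

theorem walk_const (root : Nd X F) (ch : Nd X F → Set (BaireB k) → Nd X F) (y : BaireB k) (n : ℕ)
    (h : ∀ i < n, y ∉ (walk root ch y i).C) :
    ∃ O, IsOpen O ∧ y ∈ O ∧ ∀ z ∈ O, (∀ i ≤ n, walk root ch z i = walk root ch y i) ∧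
      ∀ i < n, z ∉ (walk root ch y i).C := by
  induction n with
  | zero =>
    refine ⟨univ, isOpen_univ, trivial, fun z _ => ⟨fun i hi => ?_, fun i hi => by omega⟩⟩
    have : i = 0 := by omega
    subst this; rfl
  | succ n ih =>
    obtain ⟨O, hO, hy, hz⟩ := ih fun i hi => h i (by omega)
    have hn := h n (by omega)
    refine ⟨O ∩ mc (Dj (walk root ch y n).C) y, hO.inter (mc_open _ _),
      ⟨hy, self_mem_mc _ _⟩, ?_⟩
    rintro z ⟨hzO, hzm⟩
    obtain ⟨h1, h2⟩ := hz z hzO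
    constructor
    · intro i hi
      by_cases hi' : i ≤ n
      · exact h1 i hi'
      · have : i = n + 1 := by omega
        subst this
        have e : mc (Dj (walk root ch y n).C) z = mc (Dj (walk root ch y n).C) y :=
          mc_eq (exists_cyl_disj (walk root ch y n).hC hn) hzm
        simp only [walk]
        rw [h1 n le_rfl, e]
    · intro i hi
      by_cases hi' : i < n
      · exact h2 i hi'
      · have : i = n := by omega
        subst this
        exact disjoint_left.1 (mcD_disj (walk root ch y i).hC hn) hzm

end walk

theorem exists_FC {X : Set (BaireB k)} {F : List ℕ → Set (BaireB k)} (hF : ∀ l, IsClosed (F l))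
    (hX : Xᶜ = ⋃ t : ℕ → ℕ, ⋂ n : ℕ, F (List.ofFn fun i : Fin n => t i))
    {E : Set (BaireB k)} (hE : IsClosed E) (hP : ¬ PP (E ∩ X)) :
    ∃ K ⊆ E, IsClosed K ∧ (K ∩ X).Nonempty ∧ FC (K ∩ X) ∧ NP (K ∩ X) := by
  have hX' : ∀ x ∈ X, x ∉ ⋃ t : ℕ → ℕ, ⋂ n : ℕ, F (List.ofFn fun i : Fin n => t i) := by
    intro x hx h
    rw [← hX] at h
    exact h hx
  have hroot : ¬ sm X E (Ss F []) := by
    rintro ⟨Q, H, h1, h2, h3, h4, h5⟩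
    apply hP
    have hHX : H ⊆ X := by
      intro x hx
      by_contra hxX
      have : x ∈ Xᶜ := hxX
      rw [hX, mem_iUnion] at this
      obtain ⟨t, ht⟩ := this
      exact disjoint_left.1 h4 hx ⟨t, by simp, fun n => mem_iInter.1 ht n⟩
    have : E ∩ X = (Q ∪ H) ∩ E := by
      ext x
      constructor
      · rintro ⟨h6, h7⟩; exact ⟨h5 ⟨h7, h6⟩, h6⟩
      · rintro ⟨h6, h7⟩; exact ⟨h7, union_subset h1 hHX h6⟩
    rw [this]
    exact PP_inter (PP_union h2 (PP_gd h3)) (closed_gd hE)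
  obtain ⟨root, hrE, hrs⟩ := exists_node hF hX' hE hroot (by
    intro p hp hne
    exact (hne (List.prefix_nil.1 hp)).elim)
  have hch : ∀ (N : Nd X F) (c : Set (BaireB k)), ∃ N' : Nd X F,
      IsOpen c → IsClosed c → (N.Z ∩ c).Nonempty →
      N'.Z ⊆ N.Z ∩ c ∧ ∃ j, N'.s = N.s ++ [j] := by
    intro N c
    by_cases h : IsOpen c ∧ IsClosed c ∧ (N.Z ∩ c).Nonempty
    · obtain ⟨N', h'⟩ := exists_child hF hX' N c h.1 h.2.1 h.2.2
      exact ⟨N', fun _ _ _ => h'⟩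
    · exact ⟨N, fun h1 h2 h3 => (h ⟨h1, h2, h3⟩).elim⟩
  choose ch hch using hch
  set w : BaireB k → ℕ → Nd X F := walk root ch with hw
  have hws : ∀ y n, w y (n + 1) = ch (w y n) (mc (Dj (w y n).C) y) := fun y n => rfl
  -- one step
  have hstep : ∀ y n, y ∈ (w y n).Z →
      (w y (n + 1)).Z ⊆ (w y n).Z ∩ mc (Dj (w y n).C) y ∧
        ∃ j, (w y (n + 1)).s = (w y n).s ++ [j] := by
    intro y n hy
    rw [hws]
    exact hch _ _ (mc_open _ _) (mc_closed _ _) ⟨y, hy, self_mem_mc _ _⟩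
  have hnest : ∀ y n, (∀ i < n, y ∈ (w y i).Z) → ∀ i ≤ n, (w y n).Z ⊆ (w y i).Z := by
    intro y n
    induction n with
    | zero =>
      intro _ i hi
      have : i = 0 := by omega
      subst this; exact subset_rfl
    | succ n ih =>
      intro h i hi
      by_cases hi' : i = n + 1
      · subst hi'; exact subset_rfl
      · exact ((hstep y n (h n (by omega))).1.trans inter_subset_left).trans
          (ih (fun i hi => h i (by omega)) i (by omega))
  -- members of `TT m` lie in `Z` at each level up to `m`
  have hTZ : ∀ m y, y ∈ TT w m → ∀ i ≤ m, y ∈ (w y i).Z := by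
    intro m y hy i hi
    by_cases h : i < m
    · exact (hy.2 i h).1
    · have : i = m := by omega
      subst this; exact (w y i).hCZ hy.1
  -- relative neighborhoods
  have hnb : ∀ y n, (∀ i < n, y ∉ (w y i).C) → ∃ O, IsOpen O ∧ y ∈ O ∧
      ∀ z ∈ O, (∀ i ≤ n, w z i = w y i) ∧ ∀ i < n, z ∉ (w y i).C :=
    fun y n h => walk_const root ch y n h
  -- if y leaves the tree then a whole neighborhood avoids T
  have hleave : ∀ y n, (∀ i < n, y ∉ (w y i).C) → y ∉ (w y n).Z →
      ∃ O, IsOpen O ∧ y ∈ O ∧ ∀ z ∈ O, ∀ m, z ∉ TT w m := by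
    intro y n h hyZ
    obtain ⟨O, hO, hyO, hz⟩ := hnb y n h
    refine ⟨O ∩ ((w y n).Z)ᶜ, hO.inter (w y n).hZ.isOpen_compl, ⟨hyO, hyZ⟩, ?_⟩
    rintro z ⟨hzO, hzZ⟩ m hm
    obtain ⟨h1, h2⟩ := hz z hzO
    by_cases hmn : m < n
    · apply h2 m hmn
      rw [← h1 m hmn.le]; exact hm.1
    · apply hzZ
      rw [← h1 n le_rfl]
      exact hTZ m z hm n (by omega)
  let T : Set (BaireB k) := ⋃ n, TT w n
  -- each point outside T, which is in the closure of T, has an infinite walk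
  have hinf : ∀ y, y ∈ closure T → y ∉ T → ∀ n, y ∈ (w y n).Z ∧ y ∉ (w y n).C := by
    intro y hyc hyT n
    induction n using Nat.strong_induction_on with
    | _ n ih =>
      have hZn : y ∈ (w y n).Z := by
        by_contra hc
        obtain ⟨O, hO, hyO, hz⟩ := hleave y n (fun i hi => (ih i hi).2) hc
        obtain ⟨z, hzO, hzT⟩ := mem_closure_iff.1 hyc O hO hyO
        obtain ⟨m, hm⟩ := mem_iUnion.1 hzT
        exact hz z hzO m hm
      exact ⟨hZn, fun hC => hyT (mem_iUnion.2 ⟨n, hC, ih⟩)⟩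
  have hKX : closure T ∩ X ⊆ T := by
    rintro y ⟨hyc, hyX⟩
    by_contra hyT
    have h := hinf y hyc hyT
    refine hX' y hyX (branch_mem (σ := fun n => (w y n).s) hrs
      (fun n => (hstep y n (h n).1).2) (fun n => ?_))
    exact (w y n).hp _ (List.prefix_refl _) (h n).1
  have hKXe : closure T ∩ X = T ∩ X :=
    subset_antisymm (fun y hy => ⟨hKX hy, hy.2⟩) (inter_subset_inter_left X subset_closure)
  -- points of C in X
  have hCX : ∀ (N : Nd X F), (N.C ∩ X).Nonempty := by
    intro N
    by_contra hc
    rw [not_nonempty_iff_eq_empty] at hc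
    refine N.hCN univ isOpen_univ (by rw [inter_univ]; exact N.hCne) ?_
    rw [inter_univ, sm_univ_iff (closed_gd N.hC), hc]
    exact PP_empty
  -- density
  have hdens : ∀ n y, y ∈ TT w n → ∀ O, IsOpen O → y ∈ O → (O ∩ TT w (n + 1) ∩ X).Nonempty := by
    intro n y hy O hO hyO
    obtain ⟨O', hO', hyO', hz⟩ := hnb y n fun i hi => (hy.2 i hi).2
    obtain ⟨m, hm⟩ := exists_cyl (hO.inter hO') ⟨hyO, hyO'⟩
    obtain ⟨z, ⟨hzm, hzZ⟩, hzC⟩ := (w y n).hCD (cyl y m) (cyl_open y m)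
      ⟨y, self_mem_cyl y m, hTZ n y hy n le_rfl⟩
    have hsub := mcD_sub (w y n).hC hzC hy.1 hzm
    set c := mc (Dj (w y n).C) z with hc
    have hcC : Disjoint c (w y n).C := mcD_disj (w y n).hC hzC
    obtain ⟨hZ', _⟩ := hch (w y n) c (mc_open _ _) (mc_closed _ _) ⟨z, hzZ, self_mem_mc _ _⟩
    obtain ⟨v, hvC, hvX⟩ := hCX (ch (w y n) c)
    have hv := hZ' ((ch (w y n) c).hCZ hvC)
    have hvO := hm (hsub hv.2)
    obtain ⟨h1, h2⟩ := hz v hvO.2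
    refine ⟨v, ⟨hvO.1, ?_, ?_⟩, hvX⟩
    · rw [hws, h1 n le_rfl, mc_eq (exists_cyl_disj (w y n).hC hzC) hv.2]
      exact hvC
    · intro i hi
      rw [h1 i (by omega)]
      refine ⟨hnest y n (fun i hi => (hy.2 i hi).1) i (by omega) hv.1, ?_⟩
      by_cases hi' : i < n
      · exact h2 i hi'
      · have : i = n := by omega
        subst this
        exact disjoint_left.1 hcC hv.2
  have hdens' : ∀ j n y, y ∈ TT w n ∩ X → ∀ O, IsOpen O → y ∈ O →
      (O ∩ TT w (n + j) ∩ X).Nonempty := by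
    intro j
    induction j with
    | zero => intro n y hy O hO hyO; exact ⟨y, ⟨hyO, hy.1⟩, hy.2⟩
    | succ j ih =>
      intro n y hy O hO hyO
      obtain ⟨z, ⟨hzO, hzT⟩, hzX⟩ := ih n y hy O hO hyO
      exact hdens _ z hzT O hO hzO
  have hdisj : ∀ m n y, y ∈ TT w m → y ∈ TT w n → m = n := by
    intro m n y h1 h2
    rcases lt_trichotomy m n with h | h | h
    · exact ((h2.2 m h).2 h1.1).elim
    · exact h
    · exact ((h1.2 n h).2 h2.1).elim
  refine ⟨closure T, ?_, isClosed_closure, ?_, ?_, ?_⟩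
  · refine closure_minimal ?_ hE
    refine iUnion_subset fun n y hy => hrE ?_
    exact hTZ n y hy 0 (by omega)
  · obtain ⟨y, hyC, hyX⟩ := hCX root
    exact ⟨y, subset_closure (mem_iUnion.2 ⟨0, hyC, fun i hi => by omega⟩), hyX⟩
  · rw [hKXe]
    refine ⟨fun n => {y | ∃ i ≤ n, y ∈ TT w i}, fun n => ?_, fun n => ?_, ?_⟩
    · rw [← isOpen_compl_iff, isOpen_iff_forall_mem_open]
      intro y hy
      have hy' : ∀ i ≤ n, y ∉ TT w i := fun i hi h => hy ⟨i, hi, h⟩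
      by_cases hcase : ∀ i ≤ n, y ∈ (w y i).Z ∧ y ∉ (w y i).C
      · obtain ⟨O, hO, hyO, hz⟩ := hnb y (n + 1) fun i hi => (hcase i (by omega)).2
        refine ⟨O, ?_, hO, hyO⟩
        rintro z hzO ⟨i, hi, hzi⟩
        obtain ⟨h1, h2⟩ := hz z hzO
        apply h2 i (by omega)
        rw [← h1 i (by omega)]; exact hzi.1
      · have hex : ∃ i, i ≤ n ∧ ¬ (y ∈ (w y i).Z ∧ y ∉ (w y i).C) := by
          push Not at hcase ⊢
          exact hcase
        classical
        obtain ⟨hin, hi⟩ := Nat.find_spec hex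
        have hmin : ∀ j < Nat.find hex, y ∈ (w y j).Z ∧ y ∉ (w y j).C := by
          intro j hj
          by_contra hc
          exact Nat.find_min hex hj ⟨by omega, hc⟩
        have hnZ : y ∉ (w y (Nat.find hex)).Z := by
          intro hZ
          have hC : y ∈ (w y (Nat.find hex)).C := by
            by_contra hC
            exact hi ⟨hZ, hC⟩
          exact hy' _ hin ⟨hC, hmin⟩
        obtain ⟨O, hO, hyO, hz⟩ := hleave y _ (fun j hj => (hmin j hj).2) hnZ
        refine ⟨O, ?_, hO, hyO⟩
        rintro z hzO ⟨i, _, hzi⟩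
        exact hz z hzO i hzi
    · rintro O hO ⟨y, hyO, hyT, hyX⟩
      obtain ⟨m, hm⟩ := mem_iUnion.1 hyT
      obtain ⟨z, ⟨hzO, hzT⟩, hzX⟩ := hdens' (n + 1) m y ⟨hm, hyX⟩ O hO hyO
      refine ⟨z, ⟨hzO, mem_iUnion.2 ⟨_, hzT⟩, hzX⟩, ?_⟩
      rintro ⟨i, hi, hzi⟩
      have := hdisj _ _ z hzT hzi
      omega
    · rintro y ⟨hyT, _⟩
      obtain ⟨m, hm⟩ := mem_iUnion.1 hyT
      exact mem_iUnion.2 ⟨m, m, le_rfl, hm⟩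
  · rw [hKXe]
    rintro O hO ⟨y, hyO, hyT, hyX⟩ hPP
    obtain ⟨n, hn⟩ := mem_iUnion.1 hyT
    obtain ⟨O', hO', hyO', hz⟩ := hnb y n fun i hi => (hn.2 i hi).2
    refine (w y n).hCN (O ∩ O') (hO.inter hO') ⟨y, hn.1, hyO, hyO'⟩ ?_
    have hgd : IsGδ ((w y n).C ∩ (O ∩ O')) := (closed_gd (w y n).hC).inter (hO.inter hO').isGδ
    rw [sm_univ_iff hgd]
    have : (w y n).C ∩ (O ∩ O') ∩ X = (O ∩ (T ∩ X)) ∩ ((w y n).C ∩ (O ∩ O')) := by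
      ext z
      constructor
      · rintro ⟨⟨h1, h2, h3⟩, h4⟩
        refine ⟨⟨h2, mem_iUnion.2 ⟨n, ?_⟩, h4⟩, h1, h2, h3⟩
        obtain ⟨h5, h6⟩ := hz z h3
        refine ⟨by rw [h5 n le_rfl]; exact h1, fun i hi => ?_⟩
        rw [h5 i hi.le]
        exact ⟨hnest y n (fun i hi => (hn.2 i hi).1) i hi.le ((w y n).hCZ h1), h6 i hi⟩
      · rintro ⟨⟨h1, h2, h3⟩, h4⟩
        exact ⟨h4, h3⟩
    rw [this]
    exact PP_inter hPP hgd

end Pf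

namespace Pf

variable {k : Cardinal.{u}}

/-- Gluing together a closed set `D` and pieces in the maximal cylinders missing `D`. -/
def glue (D : Set (BaireB k)) (K : Set (BaireB k) → Set (BaireB k)) : Set (BaireB k) :=
  D ∪ {x | x ∉ D ∧ x ∈ K (mc (Dj D) x)}

theorem glue_loc {D : Set (BaireB k)} (hD : IsClosed D) {K : Set (BaireB k) → Set (BaireB k)}
    {x y : BaireB k} (hx : x ∉ D) (hy : y ∈ mc (Dj D) x) :
    y ∈ glue D K ↔ y ∈ K (mc (Dj D) x) := by
  have h1 : y ∉ D := disjoint_left.1 (mcD_disj hD hx) hy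
  have h2 : mc (Dj D) y = mc (Dj D) x := mc_eq (exists_cyl_disj hD hx) hy
  constructor
  · rintro (h | ⟨_, h⟩)
    · exact absurd h h1
    · rwa [h2] at h
  · intro h
    exact Or.inr ⟨h1, by rwa [h2]⟩

theorem glue_closed {D : Set (BaireB k)} (hD : IsClosed D) {K : Set (BaireB k) → Set (BaireB k)}
    (hK : ∀ c, IsClosed (K c)) : IsClosed (glue D K) := by
  rw [← isOpen_compl_iff, isOpen_iff_forall_mem_open]
  intro x hx
  have hxD : x ∉ D := fun h => hx (Or.inl h)
  have hxK : x ∉ K (mc (Dj D) x) := fun h => hx ((glue_loc hD hxD (self_mem_mc _ _)).2 h)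
  refine ⟨mc (Dj D) x ∩ (K (mc (Dj D) x))ᶜ, ?_, (mc_open _ _).inter (hK _).isOpen_compl,
    self_mem_mc _ _, hxK⟩
  rintro y ⟨hy, hyK⟩ h
  exact hyK ((glue_loc hD hxD hy).1 h)

theorem ND_mono {Y M M' : Set (BaireB k)} (h : ND Y M) (hM : M' ⊆ M) : ND Y M' := by
  intro O hO hne
  obtain ⟨x, hx, hxM⟩ := h O hO hne
  exact ⟨x, hx, fun h => hxM (hM h)⟩

theorem enlarge {A F : Set (BaireB k)} {S : List ℕ → Set (BaireB k)} (hS : ∀ l, IsClosed (S l))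
    (hAS : Aᶜ = ⋃ t : ℕ → ℕ, ⋂ n : ℕ, S (List.ofFn fun i : Fin n => t i))
    (hNP : NP A) {D : ℕ → Set (BaireB k)} (hD : ∀ n, IsClosed (D n)) (hDF : ∀ n, D n ⊆ F)
    (hND : ∀ n, ND A (D n)) (hAD : A ⊆ ⋃ n, D n) (n : ℕ) :
    ∃ E, IsClosed E ∧ D n ⊆ E ∧ E ⊆ F ∧ ND A E ∧ FC (E ∩ A) ∧ NP (E ∩ A) := by
  have key : ∀ c : Set (BaireB k), ∃ (K : Set (BaireB k)) (M : ℕ → Set (BaireB k)),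
      IsClosed K ∧ K ⊆ F ∧ (∀ j, IsClosed (M j)) ∧ (∀ j, ND (K ∩ A) (M j)) ∧
      K ∩ A ⊆ ⋃ j, M j ∧ NP (K ∩ A) ∧ ND A K ∧ K ⊆ c ∧
      (IsOpen c → IsClosed c → (c ∩ A).Nonempty → (K ∩ A).Nonempty) := by
    intro c
    by_cases hc : IsOpen c ∧ IsClosed c ∧ (c ∩ A).Nonempty
    · obtain ⟨hco, hcc, hne⟩ := hc
      have h1 := hNP c hco hne
      have h2 : ∃ i, ¬ PP ((c ∩ D i) ∩ A) := by
        by_contra hcon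
        push Not at hcon
        apply h1
        have : c ∩ A = ⋃ i, (c ∩ D i) ∩ A := by
          ext x
          simp only [mem_inter_iff, mem_iUnion]
          constructor
          · rintro ⟨h, h'⟩
            obtain ⟨i, hi⟩ := mem_iUnion.1 (hAD h')
            exact ⟨i, ⟨h, hi⟩, h'⟩
          · rintro ⟨i, ⟨h, _⟩, h'⟩
            exact ⟨h, h'⟩
        rw [this]
        exact PP_iUnion hcon
      obtain ⟨i, hi⟩ := h2
      obtain ⟨K, hK, hKc, hKne, ⟨M, hM1, hM2, hM3⟩, hKNP⟩ :=
        exists_FC hS hAS (hcc.inter (hD i)) hi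
      exact ⟨K, M, hKc, hK.trans (inter_subset_right.trans (hDF i)), hM1, hM2, hM3, hKNP,
        ND_mono (hND i) (hK.trans inter_subset_right), hK.trans inter_subset_left,
        fun _ _ _ => hKne⟩
    · refine ⟨∅, fun _ => ∅, isClosed_empty, empty_subset _, fun _ => isClosed_empty, ?_, ?_, ?_,
        ?_, empty_subset _, fun h1 h2 h3 => absurd ⟨h1, h2, h3⟩ hc⟩
      · rintro j O hO ⟨x, _, h, _⟩
        exact h.elim
      · rintro x ⟨h, _⟩
        exact h.elim
      · rintro O hO ⟨x, _, h, _⟩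
        exact h.elim
      · rintro O hO ⟨x, h⟩
        exact ⟨x, h, fun h => h⟩
  choose K M hKc hKF hMc hMN hKM hKN hKA hKs hKne using key
  have hdn := hD n
  set B := D n with hB
  -- density of the off-`B` part
  have hdense : ∀ O : Set (BaireB k), IsOpen O → (O ∩ (glue B K ∩ A)).Nonempty →
      ∃ y ∈ O ∩ (glue B K ∩ A), y ∉ B := by
    rintro O hO ⟨y, hyO, hyE, hyA⟩
    by_cases hyB : y ∈ B
    · obtain ⟨m, hm⟩ := exists_cyl hO hyO
      obtain ⟨x, ⟨hxc, hxA⟩, hxB⟩ := hND n (cyl y m) (cyl_open y m) ⟨y, self_mem_cyl y m, hyA⟩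
      obtain ⟨w, hwK, hwA⟩ := hKne (mc (Dj B) x) (mc_open _ _) (mc_closed _ _)
        ⟨x, self_mem_mc _ _, hxA⟩
      have hwc := hKs _ hwK
      refine ⟨w, ⟨hm (mcD_sub hdn hxB hyB hxc hwc), (glue_loc hdn hxB hwc).2 hwK, hwA⟩, ?_⟩
      exact disjoint_left.1 (mcD_disj hdn hxB) hwc
    · exact ⟨y, ⟨hyO, hyE, hyA⟩, hyB⟩
  refine ⟨glue B K, glue_closed hdn hKc, subset_union_left, ?_, ?_, ?_, ?_⟩
  · rintro x (h | ⟨_, h⟩)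
    · exact hDF n h
    · exact hKF _ h
  · intro O hO hne
    obtain ⟨x, ⟨hxO, hxA⟩, hxB⟩ := hND n O hO hne
    obtain ⟨z, ⟨⟨hzO, hzc⟩, hzA⟩, hzK⟩ := hKA (mc (Dj B) x) (O ∩ mc (Dj B) x)
      (hO.inter (mc_open _ _)) ⟨x, ⟨hxO, self_mem_mc _ _⟩, hxA⟩
    exact ⟨z, ⟨hzO, hzA⟩, fun h => hzK ((glue_loc hdn hxB hzc).1 h)⟩
  · refine ⟨fun j => glue B fun c => M c j, fun j => glue_closed hdn fun c => hMc c j, ?_, ?_⟩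
    · intro j O hO hne
      obtain ⟨y, ⟨hyO, hyE, hyA⟩, hyB⟩ := hdense O hO hne
      have hyK := (glue_loc hdn hyB (self_mem_mc _ _)).1 hyE
      obtain ⟨z, ⟨⟨hzO, hzc⟩, hzK, hzA⟩, hzM⟩ := hMN (mc (Dj B) y) j (O ∩ mc (Dj B) y)
        (hO.inter (mc_open _ _)) ⟨y, ⟨hyO, self_mem_mc _ _⟩, hyK, hyA⟩
      refine ⟨z, ⟨hzO, (glue_loc hdn hyB hzc).2 hzK, hzA⟩, fun h => hzM ?_⟩
      exact (glue_loc (K := fun c => M c j) hdn hyB hzc).1 h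
    · rintro x ⟨h | ⟨hB, h⟩, hA⟩
      · exact mem_iUnion.2 ⟨0, Or.inl h⟩
      · obtain ⟨j, hj⟩ := mem_iUnion.1 (hKM _ ⟨h, hA⟩)
        exact mem_iUnion.2 ⟨j, Or.inr ⟨hB, hj⟩⟩
  · intro O hO hne hPP
    obtain ⟨y, ⟨hyO, hyE, hyA⟩, hyB⟩ := hdense O hO hne
    have hyK := (glue_loc hdn hyB (self_mem_mc _ _)).1 hyE
    refine hKN (mc (Dj B) y) (O ∩ mc (Dj B) y) (hO.inter (mc_open _ _))
      ⟨y, ⟨hyO, self_mem_mc _ _⟩, hyK, hyA⟩ ?_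
    have : O ∩ mc (Dj B) y ∩ (K (mc (Dj B) y) ∩ A) = (O ∩ (glue B K ∩ A)) ∩ mc (Dj B) y := by
      ext z
      constructor
      · rintro ⟨⟨h1, h2⟩, h3, h4⟩
        exact ⟨⟨h1, (glue_loc hdn hyB h2).2 h3, h4⟩, h2⟩
      · rintro ⟨⟨h1, h2, h3⟩, h4⟩
        exact ⟨⟨h1, h4⟩, (glue_loc hdn hyB h4).1 h2, h3⟩
    rw [this]
    exact PP_inter hPP (mc_open _ _).isGδ

theorem FC_open {Y O : Set (BaireB k)} (h : FC Y) (hO : IsOpen O) : FC (Y ∩ O) := by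
  obtain ⟨M, h1, h2, h3⟩ := h
  refine ⟨M, h1, ?_, inter_subset_left.trans h3⟩
  rintro n W hW ⟨x, hxW, hxY, hxO⟩
  obtain ⟨z, ⟨⟨hzW, hzO⟩, hzY⟩, hzM⟩ := h2 n (W ∩ O) (hW.inter hO) ⟨x, ⟨hxW, hxO⟩, hxY⟩
  exact ⟨z, ⟨hzW, hzY, hzO⟩, hzM⟩

theorem NP_open {Y O : Set (BaireB k)} (h : NP Y) (hO : IsOpen O) : NP (Y ∩ O) := by
  rintro W hW ⟨x, hxW, hxY, hxO⟩ hP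
  refine h (W ∩ O) (hW.inter hO) ⟨x, ⟨hxW, hxO⟩, hxY⟩ ?_
  have : W ∩ O ∩ Y = W ∩ (Y ∩ O) := by
    ext z; simp only [mem_inter_iff]; tauto
  rwa [this]

/-- the cylinder pieces -/
def piece (R : Set (BaireB k) → Prop) (U : Set (BaireB k)) (m : ℕ) (l : List (DiscT k)) :
    Set (BaireB k) :=
  {x | x ∉ U ∧ lev R x = m ∧ List.ofFn (fun i : Fin m => x i) = l}

theorem piece_clopen {R : Set (BaireB k) → Prop} {U : Set (BaireB k)}
    (hR : ∀ x, x ∉ U → ∃ n, R (cyl x n)) (hRU : ∀ c, R c → Disjoint c U)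
    (m : ℕ) (l : List (DiscT k)) :
    piece R U m l = ∅ ∨ ∃ x, R (cyl x m) ∧ piece R U m l = cyl x m := by
  rcases eq_empty_or_nonempty (piece R U m l) with h | ⟨x, hxU, rfl, rfl⟩
  · exact Or.inl h
  · have hs : R (mc R x) := mc_spec (hR x hxU)
    refine Or.inr ⟨x, hs, ?_⟩
    ext y
    constructor
    · rintro ⟨hyU, hyl, hy⟩
      rw [mem_cyl]
      intro i hi
      exact congrFun (List.ofFn_injective hy) ⟨i, hi⟩
    · intro hy
      refine ⟨disjoint_left.1 (hRU _ hs) hy, lev_eq (hR x hxU) hy, ?_⟩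
      congr 1
      funext i
      exact hy i i.2

theorem cyl_dist {x y z : BaireB k} {m : ℕ} (hy : y ∈ cyl x m) (hz : z ∈ cyl x m) :
    dist y z ≤ (1 / 2 : ℝ) ^ m := by
  apply PiNat.mem_cylinder_iff_dist_le.1
  have : y ∈ cyl z m := by
    rw [cyl_eq hz]; exact hy
  exact this

end Pf

/-- Lemma `as`: decomposing a first-category, nowhere
`σLW(<k) + 𝒢_δσ` co-Souslin set `A ⊆ F` into a σ-discrete family of small pieces. -/
theorem stmt_5 (k : Cardinal.{u}) (hk : Cardinal.aleph0 < k)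
    (F A : Set (BaireB k)) (hF : IsFsigmaSet F) (hAF : A ⊆ F)
    (hco : IsSuslinIn Aᶜ) (hcat : FirstCategory ↥A)
    (hnw : NowhereSLWplusGDS ↥A k)
    (ε : ℝ) (hε : 0 < ε) :
    ∃ Aa : ℕ → DiscT k → Set (BaireB k),
      (∀ i α, Aa i α ⊆ A) ∧
      -- (b1)
      (⋃ i, ⋃ α, Aa i α) = A ∧ (∀ i α, Metric.diam (Aa i α) < ε) ∧
      -- (b2)
      (∀ i α, FirstCategory ↥(Aa i α) ∧ NowhereSLWplusGDS ↥(Aa i α) k) ∧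
      -- (b3)
      (∀ i α, IsClosed (Subtype.val ⁻¹' (Aa i α) : Set ↥A) ∧
        IsNowhereDense (Subtype.val ⁻¹' (Aa i α) : Set ↥A) ∧
        closure (Aa i α) ⊆ F) ∧
      -- (b4)
      (∀ i α j β, (i, α) ≠ (j, β) →
        Disjoint (closure (Aa i α)) (closure (Aa j β))) ∧
      -- (b5)
      (∀ i, DiscreteFamily fun α => Aa i α) := by
  classical
  obtain ⟨Fm, hFm, hFe⟩ := hF
  obtain ⟨S, hS, hAS⟩ := hco
  have hNP : Pf.NP A := Pf.NP_iff.1 hnw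
  obtain ⟨M, hM1, hM2, hM3⟩ := Pf.FC_iff.1 hcat
  have hDF : ∀ n : ℕ, M n.unpair.1 ∩ Fm n.unpair.2 ⊆ F := by
    intro n x hx
    rw [hFe]
    exact mem_iUnion.2 ⟨_, hx.2⟩
  have hAD : A ⊆ ⋃ n : ℕ, M n.unpair.1 ∩ Fm n.unpair.2 := by
    intro x hx
    obtain ⟨a, ha⟩ := mem_iUnion.1 (hM3 hx)
    have hxF := hAF hx
    rw [hFe] at hxF
    obtain ⟨b, hb⟩ := mem_iUnion.1 hxF
    refine mem_iUnion.2 ⟨Nat.pair a b, ?_⟩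
    rw [Nat.unpair_pair]
    exact ⟨ha, hb⟩
  have henl := Pf.enlarge hS hAS hNP
    (D := fun n : ℕ => M n.unpair.1 ∩ Fm n.unpair.2)
    (fun n => (hM1 _).inter (hFm _)) hDF
    (fun n => Pf.ND_mono (hM2 _) inter_subset_left) hAD
  choose E hEc hDE hEF hEND hEFC hENP using henl
  obtain ⟨m0, hm0⟩ := exists_pow_lt_of_lt_one hε (by norm_num : (1 / 2 : ℝ) < 1)
  let U : ℕ → Set (BaireB k) := fun n => ⋃ j ∈ Finset.range n, E j
  have hUc : ∀ n, IsClosed (U n) := fun n =>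
    isClosed_biUnion_finset fun j _ => hEc j
  have hU : ∀ n x, x ∈ U n ↔ ∃ j < n, x ∈ E j := by
    intro n x
    simp only [U, mem_iUnion, Finset.mem_range, exists_prop]
  let R : ℕ → Set (BaireB k) → Prop := fun n c =>
    Disjoint c (U n) ∧ ∀ x ∈ c, ∀ y ∈ c, dist x y ≤ (1 / 2 : ℝ) ^ m0
  have hR : ∀ n x, x ∉ U n → ∃ p, R n (Pf.cyl x p) := by
    intro n x hx
    obtain ⟨p, hp⟩ := Pf.exists_cyl_disj (hUc n) hx
    refine ⟨max p m0, hp.mono_left (Pf.cyl_anti x (le_max_left _ _)), ?_⟩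
    intro y hy z hz
    exact Pf.cyl_dist (Pf.cyl_anti x (le_max_right _ _) hy) (Pf.cyl_anti x (le_max_right _ _) hz)
  have hRU : ∀ n c, R n c → Disjoint c (U n) := fun n c h => h.1
  have hinf : Infinite (DiscT k) := by
    rw [Cardinal.infinite_iff]
    have : Cardinal.mk (DiscT k) = k := Cardinal.mk_out k
    rw [this]
    exact hk.le
  obtain ⟨e⟩ : Nonempty (DiscT k ≃ List (DiscT k)) :=
    Cardinal.eq.1 (Cardinal.mk_list_eq_mk (DiscT k)).symm
  let P : ℕ → DiscT k → Set (BaireB k) := fun i α =>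
    Pf.piece (R i.unpair.1) (U i.unpair.1) i.unpair.2 (e α)
  have hP : ∀ i α, P i α = ∅ ∨
      ∃ x, R i.unpair.1 (Pf.cyl x i.unpair.2) ∧ P i α = Pf.cyl x i.unpair.2 :=
    fun i α => Pf.piece_clopen (hR _) (hRU _) _ _
  have hPo : ∀ i α, IsOpen (P i α) := by
    intro i α
    rcases hP i α with h | ⟨x, _, h⟩
    · rw [h]; exact isOpen_empty
    · rw [h]; exact Pf.cyl_open _ _
  have hPc : ∀ i α, IsClosed (P i α) := by
    intro i α
    rcases hP i α with h | ⟨x, _, h⟩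
    · rw [h]; exact isClosed_empty
    · rw [h]; exact Pf.cyl_closed _ _
  have hcl : ∀ i α, closure ((E i.unpair.1 ∩ A) ∩ P i α) ⊆ E i.unpair.1 ∩ P i α := by
    intro i α
    apply closure_minimal
    · rintro x ⟨⟨h1, _⟩, h2⟩
      exact ⟨h1, h2⟩
    · exact (hEc _).inter (hPc i α)
  refine ⟨fun i α => (E i.unpair.1 ∩ A) ∩ P i α, ?_, ?_, ?_, ?_, ?_, ?_, ?_⟩
  · rintro i α x ⟨⟨_, h⟩, _⟩
    exact h
  · ext x
    constructor
    · intro h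
      obtain ⟨i, hi⟩ := mem_iUnion.1 h
      obtain ⟨α, hα⟩ := mem_iUnion.1 hi
      exact hα.1.2
    · intro hx
      have hex : ∃ n, x ∈ E n := by
        obtain ⟨n, hn⟩ := mem_iUnion.1 (hAD hx)
        exact ⟨n, hDE n hn⟩
      have hnU : x ∉ U (Nat.find hex) := by
        rw [hU]
        rintro ⟨j, hj, hxj⟩
        exact Nat.find_min hex hj hxj
      refine mem_iUnion.2 ⟨Nat.pair (Nat.find hex) (Pf.lev (R (Nat.find hex)) x), mem_iUnion.2
        ⟨e.symm (List.ofFn fun i : Fin (Pf.lev (R (Nat.find hex)) x) => x i), ?_⟩⟩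
      simp only [P, Nat.unpair_pair, Equiv.apply_symm_apply]
      exact ⟨⟨Nat.find_spec hex, hx⟩, hnU, rfl, rfl⟩
  · intro i α
    refine lt_of_le_of_lt (Metric.diam_le_of_forall_dist_le (by positivity) ?_) hm0
    rintro x ⟨_, hx⟩ y ⟨_, hy⟩
    rcases hP i α with h | ⟨z, hz, h⟩
    · rw [h] at hx; exact hx.elim
    · rw [h] at hx hy
      exact hz.2 x hx y hy
  · intro i α
    exact ⟨Pf.FC_iff.2 (Pf.FC_open (hEFC _) (hPo i α)),
      Pf.NP_iff.2 (Pf.NP_open (hENP _) (hPo i α))⟩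
  · intro i α
    have hpre : (Subtype.val ⁻¹' ((E i.unpair.1 ∩ A) ∩ P i α) : Set ↥A) =
        Subtype.val ⁻¹' (E i.unpair.1 ∩ P i α) := by
      ext x
      exact ⟨fun h => ⟨h.1.1, h.2⟩, fun h => ⟨⟨h.1, x.2⟩, h.2⟩⟩
    have hc : IsClosed (E i.unpair.1 ∩ P i α) := (hEc _).inter (hPc i α)
    refine ⟨?_, ?_, (hcl i α).trans (inter_subset_left.trans (hEF _))⟩
    · rw [hpre]
      exact hc.preimage continuous_subtype_val
    · rw [hpre]
      exact Pf.ND_imp hc (Pf.ND_mono (hEND _) inter_subset_left)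
  · intro i α j β hne
    rw [disjoint_left]
    intro x hx hx'
    obtain ⟨h1, h2, h3, h4⟩ := hcl i α hx
    obtain ⟨h1', h2', h3', h4'⟩ := hcl j β hx'
    have hn : i.unpair.1 = j.unpair.1 := by
      rcases lt_trichotomy i.unpair.1 j.unpair.1 with h | h | h
      · exact absurd ((hU _ _).2 ⟨_, h, h1⟩) h2'
      · exact h
      · exact absurd ((hU _ _).2 ⟨_, h, h1'⟩) h2
    rw [← hn] at h3'
    have hm : i.unpair.2 = j.unpair.2 := h3.symm.trans h3'
    have hij : i = j := by
      rw [← Nat.pair_unpair i, ← Nat.pair_unpair j, hn, hm]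
    subst hij
    apply hne
    rw [e.injective (h4.symm.trans h4')]
  · intro i x
    refine ⟨Pf.cyl x i.unpair.2, (Pf.cyl_open _ _).mem_nhds (Pf.self_mem_cyl _ _), ?_⟩
    rintro α ⟨y, ⟨_, _, _, hy⟩, hyx⟩ β ⟨z, ⟨_, _, _, hz⟩, hzx⟩
    apply e.injective
    rw [← hy, ← hz]
    congr 1
    funext j
    exact (hyx j j.2).trans (hzx j j.2).symm
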